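/- arXiv:math/0406591 — 5 statements merged into one kernel-verified Lean document; each statement's English description precedes it below -/
import Mathlib

section
/- Let d, m, b, γ be integers with 2 ≤ m ≤ d, b ≥ 1 odd, γ ∈ {−1, 0, 1}, and d − m + γ ≥ 0. Then there exist points p_1, …, p_b, q ∈ ℂ² such that the ℂ-vector space of polynomials f ∈ ℂ[x,y] of total degree at most d that vanish to order at least m at each p_i and to order at least d − m + γ at q has dimension exactly max(C(d+2,2) − b·C(m+1,2) − C(d−m+γ+1,2), 0). -/
open MvPolynomial

/-- The ideal of polynomials in `ℂ[x,y]` vanishing at the point `p ∈ ℂ²`;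
`f` vanishes to order at least `m` at `p` iff `f ∈ (ptIdeal p) ^ m`. -/
noncomputable def ptIdeal (p : ℂ × ℂ) : Ideal (MvPolynomial (Fin 2) ℂ) :=
  Ideal.span {X 0 - C p.1, X 1 - C p.2}

/-- There are `m(m+1)/2` monomials of degree less than `m` in two variables. -/
theorem card_degree_lt (m : ℕ) :
    Nat.card {s : Fin 2 →₀ ℕ // s.degree < m} = (m + 1).choose 2 := by
  let e : {s : Fin 2 →₀ ℕ // s.degree < m} ≃ {x : ℕ × ℕ // x.1 + x.2 < m} :=
    (Finsupp.equivFunOnFinite.trans (finTwoArrowEquiv ℕ)).subtypeEquiv fun s => by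
      simp [Finsupp.degree_eq_sum, finTwoArrowEquiv]
  let e' : {x : ℕ × ℕ // x.1 + x.2 < m} ≃ (Σ i : Fin m, Fin ((i : ℕ) + 1)) :=
    { toFun := fun x => ⟨⟨x.1.1 + x.1.2, x.2⟩, ⟨x.1.1, by simp only; omega⟩⟩
      invFun := fun y => ⟨(y.2, y.1 - y.2), by have := y.2.2; have := y.1.2; simp only; omega⟩
      left_inv := fun x => by ext <;> simp
      right_inv := fun y => by
        obtain ⟨⟨i, hi⟩, ⟨j, hj⟩⟩ := y
        simp only at hj
        have h : j + (i - j) = i := by omega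
        simp only [Sigma.mk.injEq, Fin.mk.injEq]
        refine ⟨h, ?_⟩
        congr 1
        · rw [h]
        · simp only [h]; rfl }
  rw [Nat.card_congr (e.trans e'), Nat.card_eq_fintype_card, Fintype.card_sigma]
  simp only [Fintype.card_fin]
  rw [Fin.sum_univ_eq_sum_range (fun i => i + 1)]
  clear e e'
  induction m with
  | zero => rfl
  | succ m ih => rw [Finset.sum_range_succ, ih, Nat.choose_succ_succ' (m + 1), Nat.choose_one_right,
      add_comm]

theorem finite_degree_lt (m : ℕ) : Finite {s : Fin 2 →₀ ℕ // s.degree < m} := by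
  rcases m with _ | m
  · have : IsEmpty {s : Fin 2 →₀ ℕ // s.degree < 0} := ⟨fun s => Nat.not_lt_zero _ s.2⟩
    infer_instance
  · exact Nat.finite_of_card_ne_zero (by rw [card_degree_lt]; exact (Nat.choose_pos (by omega)).ne')

theorem finrank_restrictTotalDegree (d : ℕ) :
    Module.finrank ℂ (restrictTotalDegree (Fin 2) ℂ d) = (d + 2).choose 2 := by
  rw [restrictTotalDegree, Module.finrank_eq_nat_card_basis (basisRestrictSupport ℂ _),
    ← card_degree_lt]
  refine Nat.card_congr (Equiv.subtypeEquivRight fun s => ?_)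
  exact Nat.lt_succ_iff.symm

/-- Translation of the plane moving the origin to `p`. -/
noncomputable def translateTo (p : ℂ × ℂ) :
    MvPolynomial (Fin 2) ℂ →ₐ[ℂ] MvPolynomial (Fin 2) ℂ :=
  aeval ![X 0 + C p.1, X 1 + C p.2]

theorem translateTo_neg_translateTo (p : ℂ × ℂ) (f : MvPolynomial (Fin 2) ℂ) :
    translateTo (-p) (translateTo p f) = f := by
  have : (translateTo (-p)).comp (translateTo p) = AlgHom.id ℂ _ := by
    ext i : 1
    fin_cases i <;> simp [translateTo]
  exact DFunLike.congr_fun this f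

theorem map_translateTo_neg_idealOfVars_le (p : ℂ × ℂ) :
    (idealOfVars (Fin 2) ℂ).map (translateTo (-p)) ≤ ptIdeal p := by
  rw [idealOfVars, Ideal.map_span, Ideal.span_le]
  rintro _ ⟨_, ⟨i, rfl⟩, rfl⟩
  fin_cases i
  · exact Ideal.subset_span (by simp [translateTo, sub_eq_add_neg])
  · exact Ideal.subset_span (by simp [translateTo, sub_eq_add_neg])

theorem mem_ptIdeal_pow_of_translateTo (p : ℂ × ℂ) (m : ℕ) (f : MvPolynomial (Fin 2) ℂ)
    (h : ∀ s : Fin 2 →₀ ℕ, s.degree < m → (translateTo p f).coeff s = 0) :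
    f ∈ ptIdeal p ^ m := by
  rw [← translateTo_neg_translateTo p f]
  refine Ideal.pow_right_mono (map_translateTo_neg_idealOfVars_le p) m ?_
  rw [← Ideal.map_pow]
  exact Ideal.mem_map_of_mem _ ((mem_pow_idealOfVars_iff' m _).2 h)

/-- The Taylor coefficients at `p` of order less than `m`. -/
noncomputable def taylorBelow (p : ℂ × ℂ) (m : ℕ) :
    MvPolynomial (Fin 2) ℂ →ₗ[ℂ] ({s : Fin 2 →₀ ℕ // s.degree < m} → ℂ) :=
  LinearMap.pi fun s => lcoeff ℂ s.1 ∘ₗ (translateTo p).toLinearMap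

/-- The dimension of a linear system is at least its expected dimension. -/
theorem expected_dim_le (d m a b : ℕ) (p : Fin b → ℂ × ℂ) (q : ℂ × ℂ) :
    (d + 2).choose 2 ≤ Module.finrank ℂ
        ↥(restrictTotalDegree (Fin 2) ℂ d ⊓
          ((⨅ i, (ptIdeal (p i) ^ m).restrictScalars ℂ) ⊓
            (ptIdeal q ^ a).restrictScalars ℂ)) +
      (b * (m + 1).choose 2 + (a + 1).choose 2) := by
  have := finite_degree_lt m
  have := finite_degree_lt a
  have := Fintype.ofFinite {s : Fin 2 →₀ ℕ // s.degree < m}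
  have := Fintype.ofFinite {s : Fin 2 →₀ ℕ // s.degree < a}
  let Φ : restrictTotalDegree (Fin 2) ℂ d →ₗ[ℂ]
      (Fin b → {s : Fin 2 →₀ ℕ // s.degree < m} → ℂ) × ({s : Fin 2 →₀ ℕ // s.degree < a} → ℂ) :=
    ((LinearMap.pi fun i => taylorBelow (p i) m).prod (taylorBelow q a)).comp
      (Submodule.subtype _)
  have hker : (LinearMap.ker Φ).map (Submodule.subtype _) ≤
      restrictTotalDegree (Fin 2) ℂ d ⊓
          ((⨅ i, (ptIdeal (p i) ^ m).restrictScalars ℂ) ⊓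
            (ptIdeal q ^ a).restrictScalars ℂ) := by
    rintro _ ⟨f, hf, rfl⟩
    have hf' : Φ f = 0 := hf
    refine ⟨f.2, ?_, ?_⟩
    · rw [SetLike.mem_coe, Submodule.mem_iInf]
      intro i
      refine mem_ptIdeal_pow_of_translateTo _ _ _ fun s hs => ?_
      exact congr_fun (congr_fun (congr_arg Prod.fst hf') i) ⟨s, hs⟩
    · refine mem_ptIdeal_pow_of_translateTo _ _ _ fun s hs => ?_
      exact congr_fun (congr_arg Prod.snd hf') ⟨s, hs⟩
  have : FiniteDimensional ℂ ↥(restrictTotalDegree (Fin 2) ℂ d ⊓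
          ((⨅ i, (ptIdeal (p i) ^ m).restrictScalars ℂ) ⊓
            (ptIdeal q ^ a).restrictScalars ℂ)) :=
    Submodule.finiteDimensional_of_le inf_le_left
  have h1 := Submodule.finrank_mono hker
  rw [Submodule.finrank_map_subtype_eq] at h1
  have h2 := LinearMap.finrank_range_add_finrank_ker Φ
  have h3 := Submodule.finrank_le (LinearMap.range Φ)
  rw [finrank_restrictTotalDegree] at h2
  rw [Module.finrank_prod, Module.finrank_pi_fintype] at h3
  simp only [Module.finrank_fintype_fun_eq_card, ← Nat.card_eq_fintype_card, card_degree_lt] at h3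
  simp at h3
  omega

/-- The numerator of `f (P / Q, τ P / Q)`, divided by `P ^ a`, for polynomials `f` of degree at
most `d` vanishing to order at least `a` at the origin. -/
noncomputable def pullback {R : Type*} [CommRing R] [Algebra ℂ R] (a d : ℕ) (P Q τ : R) :
    MvPolynomial (Fin 2) ℂ →ₗ[ℂ] R :=
  (basisMonomials (Fin 2) ℂ).constr ℂ fun s =>
    τ ^ s 1 * P ^ (s.degree - a) * Q ^ (d - s.degree)

section pullback

variable {R : Type*} [CommRing R] [Algebra ℂ R] {a d : ℕ} {P Q τ : R}

theorem pullback_apply (f : MvPolynomial (Fin 2) ℂ) :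
    pullback a d P Q τ f =
      ∑ s ∈ f.support, f.coeff s • (τ ^ s 1 * P ^ (s.degree - a) * Q ^ (d - s.degree)) := by
  conv_lhs => rw [f.as_sum]
  rw [map_sum]
  refine Finset.sum_congr rfl fun s _ => ?_
  have : monomial s (f.coeff s) = f.coeff s • basisMonomials (Fin 2) ℂ s := by
    simp [smul_monomial]
  rw [this, map_smul, pullback, Module.Basis.constr_basis]

theorem map_pullback {S : Type*} [CommRing S] [Algebra ℂ S] (g : R →ₐ[ℂ] S)
    (f : MvPolynomial (Fin 2) ℂ) :
    g (pullback a d P Q τ f) = pullback a d (g P) (g Q) (g τ) f := by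
  simp [pullback_apply, map_sum, map_smul]

/-- `f` is a combination of monomials of degree between `a` and `d`. -/
def DegreeBetween (a d : ℕ) (f : MvPolynomial (Fin 2) ℂ) : Prop :=
  ∀ s ∈ f.support, a ≤ s.degree ∧ s.degree ≤ d

theorem pullback_mul_pow {f : MvPolynomial (Fin 2) ℂ} (hf : DegreeBetween a d f) {x : R}
    (hx : x * Q = P) :
    pullback a d P Q τ f * P ^ a = Q ^ d * aeval ![x, τ * x] f := by
  rw [pullback_apply, aeval_def, eval₂_eq', Finset.sum_mul, Finset.mul_sum]
  refine Finset.sum_congr rfl fun s hs => ?_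
  obtain ⟨h1, h2⟩ := hf s hs
  have h3 : s.degree = s 0 + s 1 := by simp [Finsupp.degree_eq_sum]
  have h4 : P ^ (s.degree - a) * P ^ a = x ^ s 0 * x ^ s 1 * Q ^ s.degree := by
    rw [← pow_add, Nat.sub_add_cancel h1, ← hx, mul_pow, ← pow_add, h3]
  have h5 : Q ^ s.degree * Q ^ (d - s.degree) = Q ^ d := by
    rw [← pow_add, Nat.add_sub_cancel' h2]
  rw [Algebra.smul_def, Fin.prod_univ_two, ← h5]
  simp only [Matrix.cons_val_zero, Matrix.cons_val_one]
  linear_combination (algebraMap ℂ R) (f.coeff s) * τ ^ s 1 * Q ^ (d - s.degree) * h4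

theorem pow_dvd_pullback {f : MvPolynomial (Fin 2) ℂ} (hf : DegreeBetween a d f) {π : R}
    (hP : π ∣ P) (hQ : π ∣ Q) : π ^ (d - a) ∣ pullback a d P Q τ f := by
  rw [pullback_apply]
  refine Finset.dvd_sum fun s hs => ?_
  obtain ⟨h1, h2⟩ := hf s hs
  rw [Algebra.smul_def]
  refine Dvd.dvd.mul_left ?_ _
  rw [mul_assoc, show d - a = (s.degree - a) + (d - s.degree) by omega, pow_add]
  exact Dvd.dvd.mul_left (mul_dvd_mul (pow_dvd_pow_of_dvd hP _) (pow_dvd_pow_of_dvd hQ _)) _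

/-- Vanishing to order `m` at `p` is inherited by the pullback along a curve through `p`. -/
theorem pow_dvd_pullback_of_mem [IsDomain R] {f : MvPolynomial (Fin 2) ℂ}
    (hf : DegreeBetween a d f) {π : R} (hπ : Prime π) (hQ : ¬ π ∣ Q) (hP : ¬ π ∣ P)
    {p : ℂ × ℂ} (h1 : π ∣ P - algebraMap ℂ R p.1 * Q)
    (h2 : π ∣ τ * P - algebraMap ℂ R p.2 * Q) {m : ℕ} (hm : f ∈ ptIdeal p ^ m) :
    π ^ m ∣ pullback a d P Q τ f := by
  have hQ0 : Q ≠ 0 := fun h => hQ (h ▸ dvd_zero _)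
  let L := Localization.Away Q
  let ι := Algebra.algHom ℂ R L
  have hι : Function.Injective ι :=
    IsLocalization.injective L (powers_le_nonZeroDivisors_of_noZeroDivisors hQ0)
  have hu : IsUnit (ι Q) := IsLocalization.Away.algebraMap_isUnit Q
  obtain ⟨v, hv⟩ := hu.exists_left_inv
  set x : L := v * ι P with hx
  have hxQ : x * ι Q = ι P := by rw [hx, mul_right_comm, hv, one_mul]
  have key := pullback_mul_pow (R := L) (τ := ι τ) hf hxQ
  rw [← map_pullback] at key
  have hle : (ptIdeal p).map (aeval (R := ℂ) ![x, ι τ * x]) ≤ Ideal.span {ι π} := by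
    rw [ptIdeal, Ideal.map_span, Ideal.span_le]
    rintro _ ⟨g, hg, rfl⟩
    rw [SetLike.mem_coe, Ideal.mem_span_singleton]
    rcases hg with rfl | rfl
    · have := (map_dvd ι h1).mul_left v
      convert this using 1
      simp only [map_sub, map_mul, aeval_X, algHom_C, Matrix.cons_val_zero, AlgHom.commutes]
      linear_combination algebraMap ℂ L p.1 * hv
    · have := (map_dvd ι h2).mul_left v
      convert this using 1
      simp only [map_sub, map_mul, aeval_X, algHom_C, Matrix.cons_val_one,
        Matrix.cons_val_fin_one, AlgHom.commutes]
      linear_combination algebraMap ℂ L p.2 * hv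
  have hmem : aeval ![x, ι τ * x] f ∈ Ideal.span {ι π ^ m} := by
    rw [← Ideal.span_singleton_pow]
    refine Ideal.pow_right_mono hle m ?_
    rw [← Ideal.map_pow]
    exact Ideal.mem_map_of_mem _ hm
  have hdvd : ι (π ^ m) ∣ ι (pullback a d P Q τ f * P ^ a) := by
    rw [map_mul, map_pow, map_pow, key]
    exact (Ideal.mem_span_singleton.1 hmem).mul_left _
  obtain ⟨z, hz⟩ := hdvd
  obtain ⟨⟨w, ⟨_, e, rfl⟩⟩, hw⟩ := IsLocalization.surj (Submonoid.powers Q) z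
  have hR : pullback a d P Q τ f * P ^ a * Q ^ e = π ^ m * w := by
    apply hι
    rw [map_mul, hz, map_mul ι (π ^ m) w, mul_assoc]
    congr 1
  have h3 : π ^ m ∣ pullback a d P Q τ f * P ^ a :=
    hπ.pow_dvd_of_dvd_mul_right m (fun h => hQ (hπ.dvd_of_dvd_pow h)) ⟨w, hR⟩
  exact hπ.pow_dvd_of_dvd_mul_right m (fun h => hP (hπ.dvd_of_dvd_pow h)) h3

end pullback

open scoped Polynomial

theorem natDegree_pullback_le {S : Type*} [CommRing S] [Algebra ℂ S] {a d u v : ℕ} {P Q τ : S[X]}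
    (hP : P.natDegree ≤ v) (hQ : Q.natDegree ≤ v + u) (hτ : τ.natDegree ≤ u)
    {f : MvPolynomial (Fin 2) ℂ} (hf : DegreeBetween a d f) :
    (pullback a d P Q τ f).natDegree ≤ u * a + (v + u) * (d - a) := by
  rw [pullback_apply]
  refine Polynomial.natDegree_sum_le_of_forall_le _ _ fun s hs => ?_
  obtain ⟨h1, h2⟩ := hf s hs
  have h3 : s 1 ≤ s.degree := Finsupp.le_degree 1 s
  refine (Polynomial.natDegree_smul_le _ _).trans ?_
  refine (Polynomial.natDegree_mul_le_of_le (Polynomial.natDegree_mul_le_of_le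
    (Polynomial.natDegree_pow_le_of_le _ hτ) (Polynomial.natDegree_pow_le_of_le _ hP))
    (Polynomial.natDegree_pow_le_of_le _ hQ)).trans ?_
  obtain ⟨j, hj⟩ := Nat.exists_eq_add_of_le h1
  obtain ⟨l, hl⟩ := Nat.exists_eq_add_of_le h2
  rw [show s.degree - a = j by omega, show d - s.degree = l by omega, show d - a = j + l by omega]
  nlinarith [Nat.mul_le_mul_right u h3]

theorem coeff_coeff_swap (p : ℂ[X][X]) (i j : ℕ) :
    ((Polynomial.Bivariate.swap p).coeff i).coeff j = (p.coeff j).coeff i := by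
  induction p using Polynomial.induction_on' with
  | add p q hp hq => simp [hp, hq]
  | monomial n f =>
    induction f using Polynomial.induction_on' with
    | add p q hp hq => simp only [map_add, Polynomial.coeff_add, hp, hq]
    | monomial l c =>
      rw [Polynomial.Bivariate.swap_monomial_monomial]
      simp only [Polynomial.coeff_monomial]
      split_ifs <;> simp_all [Polynomial.coeff_monomial]

theorem coeff_prod_X_add_C_ne_zero {ι : Type*} (s : Finset ι) (c : ι → ℕ) (hc : ∀ i, c i ≠ 0)
    (l : ℕ) (hl : l ≤ s.card) :
    (∏ i ∈ s, (Polynomial.X + Polynomial.C (c i))).coeff l ≠ 0 := by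
  classical
  induction s using Finset.induction_on generalizing l with
  | empty => simp_all
  | insert i s hi ih =>
    rw [Finset.card_insert_of_notMem hi] at hl
    rw [Finset.prod_insert hi, add_mul, Polynomial.coeff_add, Polynomial.coeff_C_mul]
    rcases l with _ | l
    · simpa [hc i] using ih 0 (Nat.zero_le _)
    · rw [Polynomial.coeff_X_mul]
      have := ih l (by omega)
      omega

/-- The slopes of the lines joining the origin to the chosen points. -/
noncomputable def node (i : ℕ) : ℂ := -2 ^ i

theorem node_ne_zero (i : ℕ) : node i ≠ 0 := by simp [node]

theorem node_injective : Function.Injective node := by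
  intro i j h
  have : ((2 ^ i : ℕ) : ℂ) = ((2 ^ j : ℕ) : ℂ) := by simpa [node] using h
  exact Nat.pow_right_injective le_rfl (Nat.cast_injective this)

/-- The polynomial whose roots are the first `2 * k + 1` nodes. -/
noncomputable def nodal (k : ℕ) : ℂ[X] :=
  ∏ i ∈ Finset.range (2 * k + 1), (Polynomial.X - Polynomial.C (node i))

theorem nodal_monic (k : ℕ) : (nodal k).Monic :=
  Polynomial.monic_prod_of_monic _ _ fun _ _ => Polynomial.monic_X_sub_C _

theorem natDegree_nodal (k : ℕ) : (nodal k).natDegree = 2 * k + 1 := by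
  rw [nodal, Polynomial.natDegree_prod_of_monic _ _ fun _ _ => Polynomial.monic_X_sub_C _]
  simp

/-- The upper half of `nodal k`. -/
noncomputable def upper (k : ℕ) : ℂ[X] := nodal k /ₘ Polynomial.X ^ (k + 1)

/-- The negative of the lower half of `nodal k`. -/
noncomputable def lower (k : ℕ) : ℂ[X] := -(nodal k %ₘ Polynomial.X ^ (k + 1))

theorem nodal_eq (k : ℕ) : nodal k = Polynomial.X ^ (k + 1) * upper k - lower k := by
  rw [upper, lower, sub_neg_eq_add, add_comm, Polynomial.modByMonic_add_div]

theorem natDegree_upper_le (k : ℕ) : (upper k).natDegree ≤ k := by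
  rw [upper, Polynomial.natDegree_divByMonic _ (Polynomial.monic_X_pow _), natDegree_nodal,
    Polynomial.natDegree_X_pow]
  omega

theorem natDegree_lower_le (k : ℕ) : (lower k).natDegree ≤ k := by
  rw [lower, Polynomial.natDegree_neg]
  have := Polynomial.natDegree_modByMonic_lt (nodal k) (Polynomial.monic_X_pow (R := ℂ) (k + 1))
    (by intro h; simpa using congr_arg Polynomial.natDegree h)
  rw [Polynomial.natDegree_X_pow] at this
  omega

theorem eval_nodal {k i : ℕ} (hi : i < 2 * k + 1) : (nodal k).eval (node i) = 0 := by
  rw [nodal, Polynomial.eval_prod]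
  exact Finset.prod_eq_zero (Finset.mem_range.2 hi) (by simp)

theorem eval_lower {k i : ℕ} (hi : i < 2 * k + 1) :
    (lower k).eval (node i) = node i ^ (k + 1) * (upper k).eval (node i) := by
  have := eval_nodal hi
  rw [nodal_eq] at this
  simp only [Polynomial.eval_sub, Polynomial.eval_mul, Polynomial.eval_pow,
    Polynomial.eval_X] at this
  linear_combination -this

theorem eval_upper_ne_zero {k i : ℕ} (hi : i < 2 * k + 1) : (upper k).eval (node i) ≠ 0 := by
  intro h
  have hl := eval_lower hi
  rw [h, mul_zero] at hl
  obtain ⟨D', hD⟩ := Polynomial.dvd_iff_isRoot.2 h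
  obtain ⟨B', hB⟩ := Polynomial.dvd_iff_isRoot.2 hl
  have hX : (Polynomial.X - Polynomial.C (node i)) ≠ 0 := Polynomial.X_sub_C_ne_zero _
  have hprod : ∏ j ∈ (Finset.range (2 * k + 1)).erase i, (Polynomial.X - Polynomial.C (node j)) =
      Polynomial.X ^ (k + 1) * D' - B' := by
    refine mul_left_cancel₀ hX ?_
    rw [Finset.mul_prod_erase (Finset.range (2 * k + 1))
      (fun j => Polynomial.X - Polynomial.C (node j)) (Finset.mem_range.2 hi)]
    refine (nodal_eq k).trans ?_
    rw [hD, hB]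
    ring
  have hB' : B'.coeff k = 0 := by
    by_cases h0 : B' = 0
    · simp [h0]
    · refine Polynomial.coeff_eq_zero_of_natDegree_lt ?_
      have := natDegree_lower_le k
      rw [hB, Polynomial.natDegree_mul hX h0, Polynomial.natDegree_X_sub_C] at this
      omega
  have hmap : ∏ j ∈ (Finset.range (2 * k + 1)).erase i, (Polynomial.X - Polynomial.C (node j)) =
      (∏ j ∈ (Finset.range (2 * k + 1)).erase i,
        (Polynomial.X + Polynomial.C (2 ^ j))).map (Nat.castRingHom ℂ) := by
    rw [Polynomial.map_prod]
    refine Finset.prod_congr rfl fun j _ => ?_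
    simp [node, map_ofNat (Polynomial.C (R := ℂ)) 2]
  have hcoeff := congr_arg (Polynomial.coeff · k) (hmap.symm.trans hprod)
  simp only [Polynomial.coeff_map, Polynomial.coeff_sub, hB', sub_zero,
    Polynomial.coeff_X_pow_mul'] at hcoeff
  rw [if_neg (by omega)] at hcoeff
  refine coeff_prod_X_add_C_ne_zero ((Finset.range (2 * k + 1)).erase i) (fun j => 2 ^ j)
    (fun j => by positivity) k ?_ (by simpa using hcoeff)
  rw [Finset.card_erase_of_mem (Finset.mem_range.2 hi), Finset.card_range]
  omega

/-- The points of multiplicity `m`. -/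
noncomputable def multPoint (k i : ℕ) : ℂ × ℂ :=
  ((upper k).eval (node i), node i * (upper k).eval (node i))

/-- The pencil of rational curves through the points `multPoint k i`, with parameter the outer
variable: the inner variable is the slope, and the curve is `x = num / den`. -/
noncomputable def curveNum (k : ℕ) : ℂ[X][X] :=
  Polynomial.C (upper k) + Polynomial.X * Polynomial.C (lower k)

/-- The denominator of the first coordinate on the pencil of curves. -/
noncomputable def curveDen (k : ℕ) : ℂ[X][X] :=
  1 + Polynomial.X * Polynomial.C (Polynomial.X ^ (k + 1))

/-- The pullback of a plane polynomial to the pencil of curves. -/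
noncomputable abbrev curvePullback (a d k : ℕ) : MvPolynomial (Fin 2) ℂ →ₗ[ℂ] ℂ[X][X] :=
  pullback a d (curveNum k) (curveDen k) (Polynomial.C Polynomial.X)

section curvePullback

variable {a d k : ℕ} {f : MvPolynomial (Fin 2) ℂ}

theorem natDegree_curvePullback_le (hf : DegreeBetween a d f) :
    (curvePullback a d k f).natDegree ≤ d - a := by
  have := natDegree_pullback_le (a := a) (d := d) (u := 0) (v := 1) (P := curveNum k)
    (Q := curveDen k) (τ := Polynomial.C Polynomial.X)
    (by unfold curveNum; compute_degree) (by unfold curveDen; compute_degree) (by compute_degree) hf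
  simpa using this

theorem natDegree_coeff_curvePullback_le (hf : DegreeBetween a d f) (l : ℕ) :
    ((curvePullback a d k f).coeff l).natDegree ≤ a + (k + 1) * (d - a) := by
  have hmap (g : ℂ[X]) (hg : g.natDegree ≤ k) :
      (g.map (Polynomial.C : ℂ →+* ℂ[X])).natDegree ≤ k := Polynomial.natDegree_map_le.trans hg
  have h1 := hmap _ (natDegree_upper_le k)
  have h2 := hmap _ (natDegree_lower_le k)
  have hswap := map_pullback (a := a) (d := d) (P := curveNum k) (Q := curveDen k)
    (τ := Polynomial.C Polynomial.X) (Polynomial.Bivariate.swap (R := ℂ)).toAlgHom f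
  have hdeg := natDegree_pullback_le (a := a) (d := d) (u := 1) (v := k)
    (P := Polynomial.Bivariate.swap (curveNum k)) (Q := Polynomial.Bivariate.swap (curveDen k))
    (τ := Polynomial.Bivariate.swap (Polynomial.C Polynomial.X))
    (by
      simp only [curveNum, map_add, map_mul, Polynomial.Bivariate.swap_C,
        Polynomial.Bivariate.swap_Y]
      exact Polynomial.natDegree_add_le_of_degree_le h1
        ((Polynomial.natDegree_C_mul_le _ _).trans h2))
    (by
      simp only [curveDen, map_add, map_mul, map_one, map_pow, Polynomial.Bivariate.swap_X,
        Polynomial.Bivariate.swap_Y]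
      compute_degree)
    (by rw [Polynomial.Bivariate.swap_X]; exact Polynomial.natDegree_X_le) hf
  rw [one_mul] at hdeg
  refine Polynomial.natDegree_le_iff_coeff_eq_zero.2 fun j hj => ?_
  have h0 : (Polynomial.Bivariate.swap (curvePullback a d k f)).coeff j = 0 :=
    Polynomial.coeff_eq_zero_of_natDegree_lt
      (((congr_arg Polynomial.natDegree hswap).trans_le hdeg).trans_lt hj)
  rw [← coeff_coeff_swap, h0, Polynomial.coeff_zero]

theorem X_sub_C_pow_dvd_curvePullback (hf : DegreeBetween a d f) {i m : ℕ} (hi : i < 2 * k + 1)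
    (hm : f ∈ ptIdeal (multPoint k i) ^ m) :
    Polynomial.C ((Polynomial.X - Polynomial.C (node i)) ^ m) ∣ curvePullback a d k f := by
  rw [map_pow]
  have hD : (Polynomial.X - Polynomial.C (node i)) ∣
      upper k - Polynomial.C ((upper k).eval (node i)) := Polynomial.X_sub_C_dvd_sub_C_eval
  have hB : (Polynomial.X - Polynomial.C (node i)) ∣
      lower k - Polynomial.C ((upper k).eval (node i)) * Polynomial.X ^ (k + 1) := by
    rw [Polynomial.dvd_iff_isRoot, Polynomial.IsRoot, Polynomial.eval_sub, eval_lower hi]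
    simp only [Polynomial.eval_mul, Polynomial.eval_C, Polynomial.eval_pow, Polynomial.eval_X]
    ring
  have h1 : Polynomial.C (Polynomial.X - Polynomial.C (node i)) ∣
      curveNum k - algebraMap ℂ ℂ[X][X] (multPoint k i).1 * curveDen k := by
    have : curveNum k - algebraMap ℂ ℂ[X][X] (multPoint k i).1 * curveDen k =
        Polynomial.C (upper k - Polynomial.C ((upper k).eval (node i))) + Polynomial.X *
          Polynomial.C (lower k - Polynomial.C ((upper k).eval (node i)) *
            Polynomial.X ^ (k + 1)) := by
      simp only [curveNum, curveDen, multPoint, Polynomial.algebraMap_apply, map_sub, map_mul,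
        map_pow, Algebra.algebraMap_self_apply]
      ring
    rw [this]
    exact dvd_add (map_dvd _ hD) ((map_dvd Polynomial.C hB).mul_left _)
  refine pow_dvd_pullback_of_mem hf (Polynomial.prime_C_iff.2 (Polynomial.prime_X_sub_C _))
    ?_ ?_ h1 ?_ hm
  · intro h
    have := (Polynomial.C_dvd_iff_dvd_coeff _ _).1 h 0
    rw [Polynomial.dvd_iff_isRoot] at this
    simp [curveDen] at this
  · intro h
    have := (Polynomial.C_dvd_iff_dvd_coeff _ _).1 h 0
    rw [Polynomial.dvd_iff_isRoot] at this
    simp [curveNum, eval_upper_ne_zero hi] at this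
  · have : Polynomial.C Polynomial.X * curveNum k -
        algebraMap ℂ ℂ[X][X] (multPoint k i).2 * curveDen k =
        Polynomial.C (Polynomial.X - Polynomial.C (node i)) * curveNum k +
        Polynomial.C (Polynomial.C (node i)) *
          (curveNum k - algebraMap ℂ ℂ[X][X] (multPoint k i).1 * curveDen k) := by
      simp only [multPoint, Polynomial.algebraMap_apply, map_sub, map_mul,
        Algebra.algebraMap_self_apply]
      ring
    rw [this]
    exact dvd_add (dvd_mul_right _ _) (h1.mul_left _)

theorem nodal_pow_dvd_curvePullback (hf : DegreeBetween a d f) {m : ℕ}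
    (hm : ∀ i < 2 * k + 1, f ∈ ptIdeal (multPoint k i) ^ m) :
    Polynomial.C (nodal k ^ m) ∣ curvePullback a d k f := by
  rw [Polynomial.C_dvd_iff_dvd_coeff]
  intro l
  rw [nodal, ← Finset.prod_pow]
  refine Finset.prod_dvd_of_coprime (fun i _ j _ hij => ?_) fun i hi => ?_
  · exact (Polynomial.isCoprime_X_sub_C_of_isUnit_sub
      (sub_ne_zero.2 (node_injective.ne hij)).isUnit).pow
  · have hi := Finset.mem_range.1 hi
    exact (Polynomial.C_dvd_iff_dvd_coeff _ _).1
      (X_sub_C_pow_dvd_curvePullback hf hi (hm i hi)) l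

/-- The pencil of curves covers the plane. -/
theorem eq_zero_of_curvePullback_eq_zero (hf : DegreeBetween a d f)
    (h : curvePullback a d k f = 0) : f = 0 := by
  have h1 : ∀ x t : ℂ, (nodal k).eval t ≠ 0 → x * t ^ (k + 1) - (lower k).eval t ≠ 0 →
      aeval ![x, t * x] f = 0 := by
    intro x t hT hx
    set s := ((upper k).eval t - x) / (x * t ^ (k + 1) - (lower k).eval t) with hs
    have hnum : Polynomial.aevalAeval t s (curveNum k) =
        (upper k).eval t + s * (lower k).eval t := by
      simp only [curveNum, map_add, map_mul, Polynomial.aevalAeval_C, Polynomial.aevalAeval_Y,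
        Polynomial.coe_aeval_eq_eval]
    have hden : Polynomial.aevalAeval t s (curveDen k) = 1 + s * t ^ (k + 1) := by
      simp [curveDen]
    have hne : (1 : ℂ) + s * t ^ (k + 1) =
        (nodal k).eval t / (x * t ^ (k + 1) - (lower k).eval t) := by
      rw [hs, nodal_eq]
      simp only [Polynomial.eval_sub, Polynomial.eval_mul, Polynomial.eval_pow, Polynomial.eval_X]
      field_simp
      ring
    have hxQ : x * (1 + s * t ^ (k + 1)) = (upper k).eval t + s * (lower k).eval t := by
      rw [hs]
      field_simp
      ring
    have hpull := pullback_mul_pow (τ := t) hf hxQ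
    have hmap := map_pullback (a := a) (d := d) (P := curveNum k) (Q := curveDen k)
      (τ := Polynomial.C Polynomial.X) (Polynomial.aevalAeval (R := ℂ) t s) f
    rw [h, map_zero, hnum, hden, Polynomial.aevalAeval_X] at hmap
    rw [← hmap, zero_mul] at hpull
    refine (mul_eq_zero.1 hpull.symm).resolve_left (pow_ne_zero _ ?_)
    rw [hne]
    exact div_ne_zero hT hx
  have eval_poly (u v : ℂ[X]) (z : ℂ) :
      (aeval ![u, v] f : ℂ[X]).eval z = aeval ![u.eval z, v.eval z] f := by
    rw [← Polynomial.coe_aeval_eq_eval, ← AlgHom.comp_apply]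
    congr 1
    ext i
    fin_cases i <;> simp
  have h2 : ∀ x t : ℂ, t ≠ 0 → (nodal k).eval t ≠ 0 → aeval ![x, t * x] f = 0 := by
    intro x t ht hT
    have : (aeval ![Polynomial.X, Polynomial.C t * Polynomial.X] f : ℂ[X]) = 0 := by
      refine Polynomial.eq_zero_of_infinite_isRoot _ (Set.Infinite.mono ?_
        (Set.finite_singleton ((lower k).eval t / t ^ (k + 1))).infinite_compl)
      intro z hz
      have := h1 z t hT fun h0 => hz (by
        rw [Set.mem_singleton_iff, eq_div_iff (pow_ne_zero _ ht)]
        linear_combination h0)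
      simpa [Polynomial.IsRoot, eval_poly] using this
    simpa [eval_poly] using congr_arg (Polynomial.eval x) this
  have h3 : ∀ x t : ℂ, aeval ![x, x * t] f = 0 := by
    intro x t
    have : (aeval ![Polynomial.C x, Polynomial.C x * Polynomial.X] f : ℂ[X]) = 0 := by
      have hfin : ({z | (Polynomial.X * nodal k).IsRoot z}).Finite :=
        Polynomial.finite_setOfPred_isRoot
          (mul_ne_zero Polynomial.X_ne_zero (nodal_monic k).ne_zero)
      refine Polynomial.eq_zero_of_infinite_isRoot _ (Set.Infinite.mono ?_ hfin.infinite_compl)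
      intro z hz
      simp only [Set.mem_compl_iff, Set.mem_ofPred_eq, Polynomial.IsRoot, Polynomial.eval_mul,
        Polynomial.eval_X, mul_eq_zero, not_or] at hz
      have := h2 x z hz.1 hz.2
      rw [mul_comm z x] at this
      simpa [Polynomial.IsRoot, eval_poly] using this
    simpa [eval_poly] using congr_arg (Polynomial.eval t) this
  have h4 : ∀ x y : ℂ, aeval ![x, y] f = 0 := by
    intro x y
    have : (aeval ![Polynomial.X, Polynomial.C y] f : ℂ[X]) = 0 := by
      refine Polynomial.eq_zero_of_infinite_isRoot _ (Set.Infinite.mono ?_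
        (Set.finite_singleton (0 : ℂ)).infinite_compl)
      intro z hz
      have := h3 z (y / z)
      rw [mul_div_cancel₀ y hz] at this
      simpa [Polynomial.IsRoot, eval_poly] using this
    simpa [eval_poly] using congr_arg (Polynomial.eval x) this
  refine MvPolynomial.funext fun z => ?_
  have hz : ![z 0, z 1] = z := by
    ext i
    fin_cases i <;> rfl
  rw [map_zero, ← MvPolynomial.coe_aeval_eq_eval, ← hz]
  exact h4 (z 0) (z 1)

end curvePullback

/-- Vandermonde: power-sum conditions with distinct bases on `S` are independent. -/
theorem finrank_add_card_le_of_sum_pow {ι : Type*} [Fintype ι] {b : ℕ} (S : Finset ι)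
    (hS : S.card ≤ b) {w v : ι → ℂ} (hw : ∀ x, w x ≠ 0) (hv : Set.InjOn v S)
    (W : Submodule ℂ (ι → ℂ)) (hW : ∀ h ∈ W, ∀ i < b, ∑ x, h x * w x * v x ^ i = 0) :
    Module.finrank ℂ W + S.card ≤ Fintype.card ι := by
  classical
  let res : W →ₗ[ℂ] ({x // x ∉ S} → ℂ) :=
    (LinearMap.funLeft ℂ ℂ (Subtype.val : {x // x ∉ S} → ι)) ∘ₗ W.subtype
  have hres : Function.Injective res := by
    rw [injective_iff_map_eq_zero]
    rintro ⟨h, hh⟩ h0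
    have hoff : ∀ x ∉ S, h x = 0 := fun x hx => congr_fun h0 ⟨x, hx⟩
    let e : Fin S.card ≃ S := S.equivFin.symm
    have hvand := Matrix.eq_zero_of_forall_pow_sum_mul_pow_eq_zero
      (f := fun j => v (e j)) (v := fun j => h (e j) * w (e j))
      (fun j j' hjj => e.injective (Subtype.ext (hv (e j).2 (e j').2 hjj)))
      (fun i => by
        rw [e.sum_comp (fun x : S => h x * w x * v x ^ (i : ℕ)),
          Finset.sum_coe_sort S (fun x => h x * w x * v x ^ (i : ℕ)),
          ← hW h hh i (i.2.trans_le hS)]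
        refine Finset.sum_subset (Finset.subset_univ _) fun x _ hx => ?_
        simp [hoff x hx])
    ext x
    by_cases hx : x ∈ S
    · have := congr_fun hvand (e.symm ⟨x, hx⟩)
      simpa [hw x] using this
    · exact hoff x hx
  have h1 := LinearMap.finrank_le_finrank_of_injective hres
  rw [Module.finrank_fintype_fun_eq_card, Fintype.card_subtype_compl, Fintype.card_coe] at h1
  have h2 := Finset.card_le_univ S
  omega

/-- The linear system with the chosen points. -/
noncomputable def linSystem (d m a k : ℕ) : Submodule ℂ (MvPolynomial (Fin 2) ℂ) :=
  restrictTotalDegree (Fin 2) ℂ d ⊓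
    ((⨅ i : Fin (2 * k + 1), (ptIdeal (multPoint k i) ^ m).restrictScalars ℂ) ⊓
      (ptIdeal 0 ^ a).restrictScalars ℂ)

section linSystem

variable {d m a k : ℕ} {f : MvPolynomial (Fin 2) ℂ}

theorem degreeBetween_of_mem (hf : f ∈ linSystem d m a k) : DegreeBetween a d f := by
  intro s hs
  constructor
  · have h0 : ptIdeal 0 = idealOfVars (Fin 2) ℂ := by
      rw [ptIdeal, idealOfVars]
      congr 1
      ext g
      simp [Fin.exists_fin_two, eq_comm]
    have := hf.2.2
    rw [h0] at this
    exact (mem_pow_idealOfVars_iff a f).1 this s hs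
  · exact (le_totalDegree hs).trans ((mem_restrictTotalDegree _ _ _).1 hf.1)

theorem mem_ptIdeal_of_mem (hf : f ∈ linSystem d m a k) (i : ℕ) (hi : i < 2 * k + 1) :
    f ∈ ptIdeal (multPoint k i) ^ m :=
  (Submodule.mem_iInf _).1 hf.2.1 ⟨i, hi⟩

/-- The bivariate polynomial with given coefficients. -/
noncomputable def ofCoeffs (n N : ℕ) : (Fin n × Fin N → ℂ) →ₗ[ℂ] ℂ[X][X] :=
  Fintype.linearCombination ℂ fun x =>
    Polynomial.C (Polynomial.X ^ (x.2 : ℕ)) * Polynomial.X ^ (x.1 : ℕ)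

theorem eq_ofCoeffs {n N : ℕ} {H : ℂ[X][X]} (h1 : ∀ l, n ≤ l → H.coeff l = 0)
    (h2 : ∀ l j, N ≤ j → (H.coeff l).coeff j = 0) :
    H = ofCoeffs n N fun x => (H.coeff x.1).coeff x.2 := by
  ext l j
  simp only [ofCoeffs, Fintype.linearCombination_apply, Polynomial.finsetSum_coeff,
    Polynomial.coeff_smul, Polynomial.coeff_C_mul, Polynomial.coeff_X_pow, smul_eq_mul]
  simp only [mul_ite, mul_one, mul_zero, apply_ite (fun q : ℂ[X] => q.coeff j),
    Polynomial.coeff_X_pow, Polynomial.coeff_zero]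
  by_cases hl : l < n
  · by_cases hj : j < N
    · rw [Finset.sum_eq_single (⟨l, hl⟩, ⟨j, hj⟩)]
      · simp
      · rintro ⟨x, y⟩ - hxy
        simp only [ne_eq, Prod.mk.injEq, Fin.ext_iff] at hxy
        grind
      · simp
    · rw [h2 l j (by omega), Finset.sum_eq_zero]
      intro x _
      have := x.2.2
      grind
  · rw [h1 l (by omega), Polynomial.coeff_zero, Finset.sum_eq_zero]
    intro x _
    have := x.1.2
    grind

/-- The pullback of a member of the linear system is the `m`-th power of the nodal polynomial
times a polynomial of small degree. -/
theorem exists_ofCoeffs (hf : f ∈ linSystem d m a k) :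
    ∃ h, curvePullback a d k f = Polynomial.C (nodal k ^ m) *
      ofCoeffs (d - a + 1) (a + (k + 1) * (d - a) + 1 - m * (2 * k + 1)) h := by
  have hb := degreeBetween_of_mem hf
  obtain ⟨H, hH⟩ := nodal_pow_dvd_curvePullback hb (mem_ptIdeal_of_mem hf)
  have hT : nodal k ^ m ≠ 0 := pow_ne_zero _ (nodal_monic k).ne_zero
  refine ⟨_, hH.trans (congr_arg _ (eq_ofCoeffs (fun l hl => ?_) fun l j hj => ?_))⟩
  · refine Polynomial.coeff_eq_zero_of_natDegree_lt (lt_of_le_of_lt ?_ hl)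
    have := natDegree_curvePullback_le (k := k) hb
    rwa [hH, Polynomial.natDegree_C_mul hT] at this
  · by_cases h0 : H.coeff l = 0
    · simp [h0]
    refine Polynomial.coeff_eq_zero_of_natDegree_lt ?_
    have := natDegree_coeff_curvePullback_le (k := k) hb l
    rw [hH, Polynomial.coeff_C_mul, Polynomial.natDegree_mul hT h0, Polynomial.natDegree_pow,
      natDegree_nodal] at this
    omega

theorem finrank_linSystem_le {n N : ℕ} (W : Submodule ℂ (Fin n × Fin N → ℂ))
    (hW : ∀ f ∈ linSystem d m a k, ∃ h ∈ W,
      curvePullback a d k f = Polynomial.C (nodal k ^ m) * ofCoeffs n N h) :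
    Module.finrank ℂ (linSystem d m a k) ≤ Module.finrank ℂ W := by
  have : FiniteDimensional ℂ (linSystem d m a k) := Submodule.finiteDimensional_of_le inf_le_left
  let μ : (Fin n × Fin N → ℂ) →ₗ[ℂ] ℂ[X][X] :=
    LinearMap.mulLeft ℂ (Polynomial.C (nodal k ^ m)) ∘ₗ ofCoeffs n N
  have hle : (linSystem d m a k).map (curvePullback a d k) ≤ W.map μ := by
    rintro _ ⟨f, hf, rfl⟩
    obtain ⟨h, hh, he⟩ := hW f hf
    exact ⟨h, hh, he.symm⟩
  refine le_trans ?_ ((Submodule.finrank_mono hle).trans (Submodule.finrank_map_le _ _))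
  let g : linSystem d m a k →ₗ[ℂ] (linSystem d m a k).map (curvePullback a d k) :=
    (curvePullback a d k).submoduleMap _
  refine LinearMap.finrank_le_finrank_of_injective (f := g) ?_
  rw [injective_iff_map_eq_zero]
  rintro ⟨f, hf⟩ h0
  exact Subtype.ext (eq_zero_of_curvePullback_eq_zero (degreeBetween_of_mem hf)
    (congr_arg Subtype.val h0))

/-- The parameter of the curve of the pencil having `multPoint k i` as indeterminacy. -/
noncomputable def badParam (k i : ℕ) : ℂ := -(node i ^ (k + 1))⁻¹

theorem sum_badParam_eq_zero (hf : DegreeBetween a d f) (hda : d - a = m + 1) {i n N : ℕ}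
    (hi : i < 2 * k + 1) {h : Fin n × Fin N → ℂ}
    (hh : curvePullback a d k f = Polynomial.C (nodal k ^ m) * ofCoeffs n N h) :
    ∑ x, h x * (node i ^ (x.2 : ℕ) * badParam k i ^ (x.1 : ℕ)) = 0 := by
  have hn : node i ^ (k + 1) ≠ 0 := pow_ne_zero _ (node_ne_zero i)
  let g : ℂ[X][X] →ₐ[ℂ] ℂ[X] :=
    (Polynomial.aeval (R := ℂ[X]) (Polynomial.C (badParam k i))).restrictScalars ℂ
  have hg (q : ℂ[X]) : g (Polynomial.C q) = q := by simp [g]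
  have hgX : g Polynomial.X = Polynomial.C (badParam k i) := by simp [g]
  have hmap := map_pullback (a := a) (d := d) (P := curveNum k) (Q := curveDen k)
    (τ := Polynomial.C Polynomial.X) g f
  have hdvd : (Polynomial.X - Polynomial.C (node i)) ^ (d - a) ∣ g (curvePullback a d k f) := by
    rw [hmap]
    refine pow_dvd_pullback hf ?_ ?_
    · rw [Polynomial.dvd_iff_isRoot, curveNum, map_add, map_mul, hg, hg, hgX]
      simp only [Polynomial.IsRoot, Polynomial.eval_add, Polynomial.eval_mul, Polynomial.eval_C,
        eval_lower hi, badParam]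
      field_simp
      ring
    · rw [Polynomial.dvd_iff_isRoot, curveDen, map_add, map_mul, map_one, hg, hgX]
      simp only [Polynomial.IsRoot, Polynomial.eval_add, Polynomial.eval_mul, Polynomial.eval_C,
        Polynomial.eval_one, Polynomial.eval_pow, Polynomial.eval_X, badParam]
      field_simp
      ring
  have hX : (Polynomial.X - Polynomial.C (node i)) ≠ 0 := Polynomial.X_sub_C_ne_zero _
  have hsplit : nodal k = (Polynomial.X - Polynomial.C (node i)) *
      ∏ j ∈ (Finset.range (2 * k + 1)).erase i, (Polynomial.X - Polynomial.C (node j)) :=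
    (Finset.mul_prod_erase (Finset.range (2 * k + 1))
      (fun j => Polynomial.X - Polynomial.C (node j)) (Finset.mem_range.2 hi)).symm
  rw [hh, map_mul, hg, hda, pow_succ, hsplit, mul_pow, mul_assoc,
    mul_dvd_mul_iff_left (pow_ne_zero _ hX)] at hdvd
  have hroot := ((Polynomial.prime_X_sub_C (node i)).dvd_or_dvd hdvd).resolve_left (by
    intro hd
    have := (Polynomial.prime_X_sub_C (node i)).dvd_of_dvd_pow hd
    rw [Polynomial.dvd_iff_isRoot, Polynomial.IsRoot, Polynomial.eval_prod,
      Finset.prod_eq_zero_iff] at this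
    obtain ⟨j, hj, hj0⟩ := this
    rw [Polynomial.eval_sub, Polynomial.eval_X, Polynomial.eval_C, sub_eq_zero] at hj0
    exact (Finset.mem_erase.1 hj).1 (node_injective hj0).symm)
  rw [Polynomial.dvd_iff_isRoot, Polynomial.IsRoot, ofCoeffs, Fintype.linearCombination_apply,
    map_sum, Polynomial.eval_finsetSum] at hroot
  rw [← hroot]
  refine Finset.sum_congr rfl fun x _ => ?_
  rw [map_smul, map_mul, hg, map_pow, hgX]
  simp

end linSystem

theorem two_mul_choose_two (x : ℕ) : 2 * ((x + 1).choose 2 : ℤ) = x * (x + 1) := by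
  induction x with
  | zero => simp
  | succ x ih =>
    rw [Nat.choose_succ_succ' (x + 1), Nat.choose_one_right]
    push_cast
    linarith

theorem finrank_linSystem_le_mul (d m a k : ℕ) :
    Module.finrank ℂ (linSystem d m a k) ≤
      (d - a + 1) * (a + (k + 1) * (d - a) + 1 - m * (2 * k + 1)) := by
  have h := finrank_linSystem_le (n := d - a + 1)
    (N := a + (k + 1) * (d - a) + 1 - m * (2 * k + 1)) ⊤ fun f hf => by
      simpa using exists_ofCoeffs hf
  rwa [finrank_top, Module.finrank_fintype_fun_eq_card, Fintype.card_prod, Fintype.card_fin,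
    Fintype.card_fin] at h

/-- The simple base points imposed on the pullback when `d - a = m + 1` impose independent
conditions. -/
theorem finrank_linSystem_add_min_le {d m a k N : ℕ} (hda : d - a = m + 1)
    (hN : a + (k + 1) * (d - a) + 1 - m * (2 * k + 1) = N) :
    Module.finrank ℂ (linSystem d m a k) + min (2 * k + 1) ((m + 2) * N) ≤ (m + 2) * N := by
  let W : Submodule ℂ (Fin (m + 2) × Fin N → ℂ) := ⨅ i : Fin (2 * k + 1),
    LinearMap.ker (Fintype.linearCombination ℂ fun x : Fin (m + 2) × Fin N =>
      node i ^ (x.2 : ℕ) * badParam k i ^ (x.1 : ℕ))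
  have hle : Module.finrank ℂ (linSystem d m a k) ≤ Module.finrank ℂ W := by
    refine finrank_linSystem_le W fun f hf => ?_
    have hex := exists_ofCoeffs hf
    rw [hN, hda] at hex
    obtain ⟨h, hh⟩ := hex
    refine ⟨h, (Submodule.mem_iInf _).2 fun i => ?_, hh⟩
    rw [LinearMap.mem_ker, Fintype.linearCombination_apply]
    exact sum_badParam_eq_zero (degreeBetween_of_mem hf) hda i.2 hh
  let ν : Fin (m + 2) × Fin N → ℕ := fun x => x.2 + (k + 1) * (m + 1 - x.1)
  let S₀ : Finset (Fin (m + 2) × Fin N) :=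
    Finset.univ ×ˢ Finset.univ.filter fun j : Fin N => (j : ℕ) < k + 1
  have hS₀ : min (2 * k + 1) ((m + 2) * N) ≤ S₀.card := by
    simp only [S₀]
    rw [Finset.card_product, Finset.card_univ, Fintype.card_fin, Fin.card_filter_val_lt]
    rcases le_total N (k + 1) with h | h
    · rw [min_eq_left h]
      exact min_le_right _ _
    · rw [min_eq_right h]
      refine (min_le_left _ _).trans ?_
      nlinarith
  have hν : Set.InjOn ν S₀ := by
    rintro ⟨l, j⟩ hx ⟨l', j'⟩ hx' h
    simp only [S₀, Finset.mem_coe, Finset.mem_product, Finset.mem_filter,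
      Finset.mem_univ, true_and] at hx hx'
    have hmod := congr_arg (· % (k + 1)) h
    have hdiv := congr_arg (· / (k + 1)) h
    simp only [ν, Nat.add_mul_mod_self_left, Nat.mod_eq_of_lt hx, Nat.mod_eq_of_lt hx'] at hmod
    simp only [ν, Nat.add_mul_div_left _ _ (Nat.succ_pos k), Nat.div_eq_of_lt hx,
      Nat.div_eq_of_lt hx'] at hdiv
    have := l.2
    have := l'.2
    ext
    · simp only; omega
    · simpa using hmod
  obtain ⟨S, hSS, hS⟩ := Finset.exists_subset_card_eq hS₀
  have hfin := finrank_add_card_le_of_sum_pow (b := 2 * k + 1) S (hS ▸ min_le_left _ _)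
    (w := fun x => (-1) ^ (x.1 : ℕ) * (-1) ^ ν x) (v := fun x => 2 ^ ν x) (by simp)
    (fun x hx y hy hxy => hν (hSS hx) (hSS hy) (by
      have : ((2 ^ ν x : ℕ) : ℂ) = ((2 ^ ν y : ℕ) : ℂ) := by simpa using hxy
      exact Nat.pow_right_injective le_rfl (Nat.cast_injective this)))
    W (fun h hh i hi => by
      have hW := (Submodule.mem_iInf _).1 hh ⟨i, hi⟩
      rw [LinearMap.mem_ker, Fintype.linearCombination_apply] at hW
      have := congr_arg ((node i ^ (k + 1)) ^ (m + 1) * ·) hW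
      simp only [mul_zero, Finset.mul_sum] at this
      rw [← this]
      refine Finset.sum_congr rfl fun x _ => ?_
      have hn : node i ^ (k + 1) ≠ 0 := pow_ne_zero _ (node_ne_zero i)
      have hl : (x.1 : ℕ) ≤ m + 1 := Nat.lt_succ_iff.1 x.1.2
      have h1 : (node i ^ (k + 1)) ^ (m + 1) =
          (node i ^ (k + 1)) ^ (m + 1 - (x.1 : ℕ)) * (node i ^ (k + 1)) ^ (x.1 : ℕ) := by
        rw [← pow_add, Nat.sub_add_cancel hl]
      have h2 : (node i ^ (k + 1)) ^ (x.1 : ℕ) * badParam k i ^ (x.1 : ℕ) = (-1) ^ (x.1 : ℕ) := by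
        rw [← mul_pow, badParam, mul_neg, mul_inv_cancel₀ hn]
      have h3 : (-1) ^ ν x * ((2 : ℂ) ^ ν x) ^ i =
          node i ^ (x.2 : ℕ) * (node i ^ (k + 1)) ^ (m + 1 - (x.1 : ℕ)) := by
        have hnode : node i = -1 * 2 ^ i := by simp [node]
        rw [← pow_mul (node i), ← pow_add, hnode, mul_pow, ← pow_mul, ← pow_mul, mul_comm i]
      rw [h1, smul_eq_mul]
      linear_combination (h x * (-1) ^ (x.1 : ℕ)) * h3 - h x * node i ^ (x.2 : ℕ) *
        (node i ^ (k + 1)) ^ (m + 1 - (x.1 : ℕ)) * h2)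
  rw [hS, Fintype.card_prod, Fintype.card_fin, Fintype.card_fin] at hfin
  omega

theorem quasi_homogeneous_nonspecial (d m b : ℕ) (γ : ℤ)
    (h2m : 2 ≤ m) (hmd : m ≤ d) (hb : 1 ≤ b) (hodd : Odd b)
    (hγ : γ = -1 ∨ γ = 0 ∨ γ = 1) (ha : 0 ≤ (d : ℤ) - m + γ) :
    ∃ (p : Fin b → ℂ × ℂ) (q : ℂ × ℂ),
      (Module.finrank ℂ
        ↥(MvPolynomial.restrictTotalDegree (Fin 2) ℂ d ⊓
          ((⨅ i, (ptIdeal (p i) ^ m).restrictScalars ℂ) ⊓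
            (ptIdeal q ^ ((d : ℤ) - m + γ).toNat).restrictScalars ℂ)) : ℤ) =
      max (((d + 2).choose 2 : ℤ) - b * ((m + 1).choose 2 : ℤ) -
        (((((d : ℤ) - m + γ).toNat + 1).choose 2 : ℤ)) ) 0 := by
  obtain ⟨k, rfl⟩ := hodd
  refine ⟨fun i => multPoint k i, 0, ?_⟩
  generalize haa : ((d : ℤ) - m + γ).toNat = a
  have had : (a : ℤ) = d - m + γ := by omega
  have hlow := expected_dim_le d m a (2 * k + 1) (fun i => multPoint k i) 0
  change (Module.finrank ℂ (linSystem d m a k) : ℤ) = _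
  change _ ≤ Module.finrank ℂ (linSystem d m a k) + _ at hlow
  generalize hN : a + (k + 1) * (d - a) + 1 - m * (2 * k + 1) = N
  have hup := finrank_linSystem_le_mul d m a k
  rw [hN] at hup
  have e1 : 2 * ((d + 2).choose 2 : ℤ) = ((d + 1 : ℕ) : ℤ) * ((d + 1 : ℕ) + 1) :=
    two_mul_choose_two (d + 1)
  have e2 := two_mul_choose_two m
  have e3 := two_mul_choose_two a
  have hlow' : ((d + 2).choose 2 : ℤ) - (2 * k + 1 : ℕ) * ((m + 1).choose 2 : ℤ) -
      ((a + 1).choose 2 : ℤ) ≤ Module.finrank ℂ (linSystem d m a k) := by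
    have : ((d + 2).choose 2 : ℤ) ≤ _ := Int.ofNat_le.2 hlow
    push_cast at this ⊢
    linarith
  suffices h : ∃ U : ℤ, (Module.finrank ℂ (linSystem d m a k) : ℤ) ≤ U ∧ (U = 0 ∨
      U = ((d + 2).choose 2 : ℤ) - (2 * k + 1 : ℕ) * ((m + 1).choose 2 : ℤ) -
        ((a + 1).choose 2 : ℤ)) by
    obtain ⟨U, hU, hU' | hU'⟩ := h <;> omega
  have hNpos : N ≠ 0 → (N : ℤ) = a + (k + 1) * (m - γ) + 1 - m * (2 * k + 1) := by
    intro hN0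
    have : N + m * (2 * k + 1) = a + (k + 1) * (d - a) + 1 := by omega
    have hcast : ((d - a : ℕ) : ℤ) = m - γ := by omega
    zify at this
    rw [hcast] at this
    linarith
  have hd : (d : ℤ) = a + m - γ := by omega
  push_cast at e1
  rw [hd] at e1
  rcases hγ with rfl | hγ
  · have hup' := finrank_linSystem_add_min_le (by omega) hN
    rcases le_total ((m + 2) * N) (2 * k + 1) with h | h
    · exact ⟨0, by rw [min_eq_right h] at hup'; omega, Or.inl rfl⟩
    · refine ⟨(m + 2) * N - (2 * k + 1), ?_, Or.inr ?_⟩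
      · rw [min_eq_left h] at hup'
        zify at hup'
        linarith
      · rw [hNpos (by rintro rfl; simp at h)]
        push_cast
        refine mul_left_cancel₀ (two_ne_zero (α := ℤ)) ?_
        linear_combination -e1 + (2 * k + 1) * e2 + e3
  · refine ⟨((d - a + 1 : ℕ) : ℤ) * N, by exact_mod_cast hup, ?_⟩
    rcases eq_or_ne N 0 with h0 | h0
    · exact Or.inl (by simp [h0])
    · right
      rw [hNpos h0, show ((d - a + 1 : ℕ) : ℤ) = m - γ + 1 by omega]
      push_cast
      rcases hγ with rfl | rfl
      · refine mul_left_cancel₀ (two_ne_zero (α := ℤ)) ?_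
        linear_combination -e1 + (2 * k + 1) * e2 + e3
      · refine mul_left_cancel₀ (two_ne_zero (α := ℤ)) ?_
        linear_combination -e1 + (2 * k + 1) * e2 + e3
end

section
/- There exist points p, q_1, …, q_4, r_1, …, r_6 ∈ ℂ² such that the only polynomial f ∈ ℂ[x,y] of total degree at most 21 that vanishes at p, vanishes to order at least 6 at each q_i, and vanishes to order at least 7 at each r_j is the zero polynomial. (The linear system L_21(1, 6^4, 7^6) is empty and non-special; note C(23,2) = 1 + 4·C(7,2) + 6·C(8,2) = 253.) -/
open MvPolynomial

namespace FatPoints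

/-! ### Gaussian elimination modulo a prime on packed rows

A row of natural numbers is stored as the single number with these base-`B` digits, so that a row
operation is one multiplication and one addition. The functions are written with recursors and
bare `Nat` operations because they are evaluated by the kernel. -/

/-- `f n`, arranged so that the kernel evaluates `n` to a literal before substituting it. -/
def force {α : Type} (n : ℕ) (f : ℕ → α) : α :=
  Nat.rec (f 0) (fun k _ => f k) (Nat.add n 1)

/-- The `j`-th digit of `N` in base `B`. -/
def digit (B N j : ℕ) : ℕ := Nat.mod (Nat.div N (Nat.pow B j)) B

/-- The number `∑ j ∈ l, g j * B ^ j`. -/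
def pack (B : ℕ) (g : ℕ → ℕ) (l : List ℕ) : ℕ :=
  List.rec 0 (fun j _ s => Nat.add (Nat.mul (g j) (Nat.pow B j)) s) l

/-- Add to each row in `l` the multiple of `R` that clears digit `c` modulo `p`, given that
digit `c` of `R` is one. -/
def clearDigit (p B c R : ℕ) (l : List ℕ) : List ℕ :=
  List.rec [] (fun N _ s =>
    force (Nat.add N (Nat.mul (Nat.sub p (Nat.mod (digit B N c) p)) R)) fun N' => N' :: s) l

/-- Eliminate the columns `cols` in order, each time using the first remaining row as pivot;
the result is `true` if all the pivots are nonzero modulo `p`. -/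
def eliminates (p B : ℕ) (cols : List ℕ) : List ℕ → Bool :=
  List.rec (fun _ => true) (fun c cs ih rows => List.rec false (fun N Ns _ =>
    force (Nat.mod (Nat.pow (digit B N c) (Nat.sub p 2)) p) fun u =>
    force (pack B (fun j => Nat.mod (Nat.mul (digit B N j) u) p) (c :: cs)) fun R =>
      cond (Nat.beq (digit B R c) 1) (ih (clearDigit p B c R Ns)) false) rows) cols

theorem digit_eq (B N j : ℕ) : digit B N j = N / B ^ j % B := rfl

theorem digit_zero (B N : ℕ) : digit B N 0 = N % B := by simp [digit_eq]

theorem digit_succ (B N j : ℕ) : digit B N (j + 1) = digit B (N / B) j := by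
  rw [digit_eq, digit_eq, pow_succ', Nat.div_div_eq_div_mul]

theorem digit_add_mul {B N R c : ℕ} (h : ∀ j, digit B N j + c * digit B R j < B) (j : ℕ) :
    digit B (N + c * R) j = digit B N j + c * digit B R j := by
  induction j generalizing N R with
  | zero =>
    have h0 := h 0
    simp only [digit_zero] at h0 ⊢
    rw [← Nat.mod_eq_of_lt h0]
    simp [Nat.add_mod, Nat.mul_mod]
  | succ j ih =>
    have h0 := h 0
    have hB : 0 < B := by omega
    simp only [digit_zero] at h0
    have hdiv : (N + c * R) / B = N / B + c * (R / B) := by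
      have e : N + c * R = (N % B + c * (R % B)) + B * (N / B + c * (R / B)) := by
        conv_lhs => rw [← Nat.mod_add_div N B, ← Nat.mod_add_div R B]
        ring
      rw [e, Nat.add_mul_div_left _ _ hB, Nat.div_eq_of_lt h0, zero_add]
    simp only [digit_succ, hdiv]
    exact ih fun j => by simpa only [digit_succ] using h (j + 1)

theorem digit_mul_pow {B x : ℕ} (hx : x < B) (i j : ℕ) :
    digit B (x * B ^ i) j = if j = i then x else 0 := by
  have hB : 0 < B := by omega
  induction j generalizing i with
  | zero =>
    rw [digit_zero]
    cases i with
    | zero => simp [Nat.mod_eq_of_lt hx]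
    | succ i => simp [pow_succ, ← mul_assoc]
  | succ j ih =>
    rw [digit_succ]
    cases i with
    | zero => simp [Nat.div_eq_of_lt hx, digit_eq]
    | succ i => simp [pow_succ, ← mul_assoc, Nat.mul_div_cancel _ hB, ih]

theorem digit_pack {B : ℕ} {g : ℕ → ℕ} (hg : ∀ j, g j < B) {l : List ℕ} (hl : l.Nodup) (j : ℕ) :
    digit B (pack B g l) j = if j ∈ l then g j else 0 := by
  induction l generalizing j with
  | nil => simp [pack, digit_eq]
  | cons i l ih =>
    obtain ⟨hi, hl⟩ := List.nodup_cons.mp hl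
    have e : pack B g (i :: l) = pack B g l + 1 * (g i * B ^ i) := by
      rw [one_mul, add_comm]; rfl
    have key (j : ℕ) : digit B (pack B g l) j + 1 * digit B (g i * B ^ i) j =
        if j ∈ i :: l then g j else 0 := by
      rw [ih hl, digit_mul_pow (hg i)]
      by_cases h : j = i
      · subst h; simp [hi]
      · simp [h]
    rw [e, digit_add_mul, key]
    intro j
    rw [key]
    split_ifs
    · exact hg j
    · exact (Nat.zero_le _).trans_lt (hg j)

theorem clearDigit_eq_map (p B c R : ℕ) (l : List ℕ) :
    clearDigit p B c R l = l.map fun N => N + (p - digit B N c % p) * R := by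
  induction l with
  | nil => rfl
  | cons N l ih => rw [List.map_cons, ← ih]; rfl

/-- The value at `v` of the linear form in the variables `cols` whose coefficients are the
digits of `N`. -/
def pairing {K : Type*} [CommRing K] (B : ℕ) (cols : List ℕ) (v : ℕ → K) (N : ℕ) : K :=
  (cols.map fun j => (digit B N j : K) * v j).sum

theorem pairing_cons {K : Type*} [CommRing K] (B c : ℕ) (cs : List ℕ) (v : ℕ → K) (N : ℕ) :
    pairing B (c :: cs) v N = digit B N c * v c + pairing B cs v N := by
  simp [pairing]

theorem pairing_linear {K : Type*} [CommRing K] {B N R M : ℕ} {x y : K} {cols : List ℕ}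
    (h : ∀ j ∈ cols, (digit B M j : K) = x * digit B N j + y * digit B R j) (v : ℕ → K) :
    pairing B cols v M = x * pairing B cols v N + y * pairing B cols v R := by
  induction cols with
  | nil => simp [pairing]
  | cons c cs ih =>
    simp only [pairing_cons]
    rw [ih fun j hj => h j (List.mem_cons_of_mem _ hj), h c List.mem_cons_self]
    ring

theorem eq_zero_of_eliminates {p B : ℕ} [Fact p.Prime] {cols rows : List ℕ} {b : ℕ}
    (hcols : cols.Nodup) (hrows : ∀ N ∈ rows, ∀ j, digit B N j ≤ b)
    (hB : b + cols.length * p ^ 2 < B) (he : eliminates p B cols rows = true)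
    {v : ℕ → ZMod p} (hv : ∀ N ∈ rows, pairing B cols v N = 0) : ∀ j ∈ cols, v j = 0 := by
  have hp : 0 < p := (Fact.out : p.Prime).pos
  induction cols generalizing rows b with
  | nil => simp
  | cons c cs ih =>
    cases rows with
    | nil => cases he
    | cons N Ns =>
      set u := digit B N c ^ (p - 2) % p
      set R := pack B (fun j => digit B N j * u % p) (c :: cs)
      have he' : cond (Nat.beq (digit B R c) 1)
          (eliminates p B cs (clearDigit p B c R Ns)) false = true := he
      obtain ⟨hc, he'⟩ : digit B R c = 1 ∧ eliminates p B cs (clearDigit p B c R Ns) = true := by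
        cases hq : Nat.beq (digit B R c) 1
        · rw [hq] at he'; cases he'
        · rw [hq] at he'; exact ⟨Nat.eq_of_beq_eq_true hq, he'⟩
      rw [List.length_cons, add_mul, one_mul] at hB
      have hpB : p < B := by nlinarith
      have hdR (j : ℕ) : digit B R j = if j ∈ c :: cs then digit B N j * u % p else 0 :=
        digit_pack (fun j => (Nat.mod_lt _ hp).trans hpB) hcols j
      have hRle (j : ℕ) : digit B R j ≤ p := by
        rw [hdR]
        split_ifs
        · exact (Nat.mod_lt _ hp).le
        · exact Nat.zero_le _
      have hRv : pairing B (c :: cs) v R = 0 := by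
        rw [pairing_linear (N := N) (R := R) (x := (u : ZMod p)) (y := 0), hv N List.mem_cons_self]
        · simp
        · intro j hj
          rw [hdR, if_pos hj, ZMod.natCast_mod]
          push_cast
          ring
      have hdM (M : ℕ) (hM : M ∈ Ns) (j : ℕ) :
          digit B M j + (p - digit B M c % p) * digit B R j ≤ b + p ^ 2 := by
        rw [sq]
        exact add_le_add (hrows M (List.mem_cons_of_mem _ hM) j)
          (Nat.mul_le_mul (Nat.sub_le _ _) (hRle j))
      have hadd (M : ℕ) (hM : M ∈ Ns) := digit_add_mul
        (fun j => (hdM M hM j).trans_lt (by nlinarith [Nat.zero_le (cs.length * p ^ 2)]))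
      have hcs : ∀ j ∈ cs, v j = 0 := by
        refine ih (rows := clearDigit p B c R Ns) (b := b + p ^ 2) (List.nodup_cons.mp hcols).2
          ?_ (by omega) he' ?_
        · rw [clearDigit_eq_map, List.forall_mem_map]
          intro M hM j
          rw [hadd M hM]
          exact hdM M hM j
        · rw [clearDigit_eq_map, List.forall_mem_map]
          intro M hM
          have h0 : ((digit B (M + (p - digit B M c % p) * R) c : ℕ) : ZMod p) = 0 := by
            rw [hadd M hM, hc]
            push_cast [Nat.cast_sub (Nat.mod_lt (digit B M c) hp).le]
            simp
          have h1 := pairing_linear (N := M) (R := R) (cols := c :: cs) (x := (1 : ZMod p))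
            (y := (p - digit B M c % p : ℕ)) (M := M + (p - digit B M c % p) * R)
            (fun j _ => by rw [hadd M hM]; push_cast; ring) v
          rwa [hRv, hv M (List.mem_cons_of_mem _ hM), pairing_cons, h0, zero_mul, zero_add,
            mul_zero, mul_zero, add_zero] at h1
      have hz : pairing B cs v R = 0 := by
        refine List.sum_eq_zero fun x hx => ?_
        obtain ⟨j, hj, rfl⟩ := List.mem_map.mp hx
        rw [hcs j hj, mul_zero]
      rw [pairing_cons, hc, hz, Nat.cast_one, one_mul, add_zero] at hRv
      simpa [hRv] using hcs

/-- The matrix of a square system whose equations and variables are listed in `rows`, `cols`. -/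
def coeffMatrix {ι : Type*} {rows : List ι} {cols : List ℕ} (hlen : rows.length = cols.length)
    (e : ι → ℕ → ℕ) : Matrix (Fin cols.length) (Fin cols.length) ℤ :=
  fun i j => e (rows.get (i.cast hlen.symm)) (cols.get j)

theorem coeffMatrix_mulVec {ι F : Type*} [CommRing F] {rows : List ι} {cols : List ℕ}
    (hlen : rows.length = cols.length) (e : ι → ℕ → ℕ) (w : ℕ → F) (i : Fin cols.length) :
    (((coeffMatrix hlen e).map (Int.cast : ℤ → F)).mulVec fun j => w (cols.get j)) i =
      (cols.map fun t => (e (rows.get (i.cast hlen.symm)) t : F) * w t).sum := by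
  rw [← Fin.sum_univ_fun_getElem]
  simp [Matrix.mulVec, dotProduct, coeffMatrix, Matrix.map_apply]

/-- If a square system with natural coefficients has only the zero solution modulo a prime, then
it has only the zero solution in characteristic zero. -/
theorem eq_zero_of_eq_zero_mod {ι K : Type*} [Field K] [CharZero K] {p : ℕ} [Fact p.Prime]
    {rows : List ι} {cols : List ℕ} (hlen : rows.length = cols.length) (hcols : cols.Nodup)
    (e : ι → ℕ → ℕ)
    (hmod : ∀ v : ℕ → ZMod p, (∀ x ∈ rows, (cols.map fun t => (e x t : ZMod p) * v t).sum = 0) →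
      ∀ t ∈ cols, v t = 0)
    {v : ℕ → K} (hv : ∀ x ∈ rows, (cols.map fun t => (e x t : K) * v t).sum = 0) :
    ∀ t ∈ cols, v t = 0 := by
  set A := coeffMatrix hlen e
  have hdetp : (A.map (Int.cast : ℤ → ZMod p)).det ≠ 0 := by
    intro h
    obtain ⟨w, hw, hAw⟩ := Matrix.exists_mulVec_eq_zero_iff.mpr h
    have hinj : Function.Injective cols.get := List.nodup_iff_injective_get.mp hcols
    have hext : (fun j => Function.extend cols.get w 0 (cols.get j)) = w :=
      funext fun j => hinj.extend_apply w 0 j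
    apply hw
    have := hmod (Function.extend cols.get w 0) fun x hx => by
      obtain ⟨i, rfl⟩ := List.mem_iff_get.mp hx
      have := coeffMatrix_mulVec hlen e (Function.extend cols.get w 0) (i.cast hlen)
      rw [hext, hAw] at this
      exact this.symm
    funext j
    rw [← hext]
    exact this _ (List.get_mem _ _)
  have hdet : A.det ≠ 0 := by
    intro h
    apply hdetp
    have := (Int.castRingHom (ZMod p)).map_det A
    rw [h, map_zero] at this
    exact this.symm
  have hdetK : (A.map (Int.cast : ℤ → K)).det ≠ 0 := by
    have := (Int.castRingHom K).map_det A
    intro h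
    exact hdet (Int.cast_injective (α := K) (by rw [Int.cast_zero]; exact this.trans h))
  have hz := Matrix.eq_zero_of_mulVec_eq_zero hdetK
    (v := fun j => v (cols.get j)) (funext fun i =>
      (coeffMatrix_mulVec hlen e v i).trans (hv _ (List.get_mem _ _)))
  intro t ht
  obtain ⟨j, rfl⟩ := List.mem_iff_get.mp ht
  exact congrFun hz j

/-! ### Derivatives of polynomials with fat points -/

theorem derivation_mem_pow {R A : Type*} [CommSemiring R] [CommSemiring A] [Algebra R A]
    (D : Derivation R A A) {I : Ideal A} {n : ℕ} {f : A} (hf : f ∈ I ^ (n + 1)) : D f ∈ I ^ n := by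
  induction n generalizing f with
  | zero => simp
  | succ n ih =>
    rw [pow_succ] at hf
    induction hf using Submodule.mul_induction_on' with
    | mem_mul_mem g hg h hh =>
      rw [D.leibniz, smul_eq_mul, smul_eq_mul, mul_comm h]
      exact add_mem (Ideal.mul_mem_right _ _ hg) (pow_succ I n ▸ Ideal.mul_mem_mul (ih hg) hh)
    | add g _ h _ hg hh => rw [map_add]; exact add_mem hg hh

theorem iterate_derivation_mem_pow {R A : Type*} [CommSemiring R] [CommSemiring A] [Algebra R A]
    (D : Derivation R A A) {I : Ideal A} {n : ℕ} (i : ℕ) {f : A} (hf : f ∈ I ^ (n + i)) :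
    D^[i] f ∈ I ^ n := by
  induction i generalizing f with
  | zero => exact hf
  | succ i ih => exact ih (derivation_mem_pow D hf)

theorem iterate_pderiv_monomial {σ R : Type*} [CommSemiring R] (x : σ) (i : ℕ) (s : σ →₀ ℕ)
    (c : R) : (pderiv x)^[i] (monomial s c) =
      monomial (s - Finsupp.single x i) (c * (s x).descFactorial i) := by
  induction i with
  | zero => simp
  | succ i ih =>
    rw [Function.iterate_succ_apply', ih, pderiv_monomial, tsub_tsub, ← Finsupp.single_add,
      Nat.descFactorial_succ, Finsupp.tsub_apply, Finsupp.single_eq_same]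
    push_cast
    rw [mul_assoc, mul_comm ((s x).descFactorial i : R)]

/-- The `i`-th derivative of `x ^ k` at `a`. -/
def powDeriv (k i a : ℕ) : ℕ :=
  Nat.mul (Nat.rec 1 (fun n s => Nat.mul (Nat.sub k n) s) i) (Nat.pow a (Nat.sub k i))

theorem powDeriv_eq (k i a : ℕ) : powDeriv k i a = k.descFactorial i * a ^ (k - i) := by
  have h : (Nat.rec 1 (fun n s => Nat.mul (Nat.sub k n) s) i : ℕ) = k.descFactorial i := by
    induction i with
    | zero => rfl
    | succ i ih => rw [Nat.descFactorial_succ, ← ih]; rfl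
  rw [← h]
  rfl

/-- The exponent of the monomial `x ^ (t / 22) * y ^ (t % 22)`. -/
noncomputable def expo (t : ℕ) : Fin 2 →₀ ℕ :=
  Finsupp.single 0 (t / 22) + Finsupp.single 1 (t % 22)

/-- The value at `(a, b)` of the derivative of order `(i, j)` of the monomial with index `t`. -/
def monomialDeriv (a b i j t : ℕ) : ℕ :=
  Nat.mul (powDeriv (Nat.div t 22) i a) (powDeriv (Nat.mod t 22) j b)

theorem eval_iterate_pderiv_monomial {K : Type*} [CommRing K] (a b i j t : ℕ) (c : K) :
    eval ![(a : K), (b : K)] ((pderiv 0)^[i] ((pderiv 1)^[j] (monomial (expo t) c))) =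
      monomialDeriv a b i j t * c := by
  have h : monomialDeriv a b i j t = powDeriv (t / 22) i a * powDeriv (t % 22) j b := rfl
  rw [iterate_pderiv_monomial, iterate_pderiv_monomial, eval_monomial, h, powDeriv_eq, powDeriv_eq,
    Finsupp.prod_fintype _ _ (by simp)]
  simp [expo]
  ring

theorem eq_sum_monomial_expo {K : Type*} [CommRing K] {cols : List ℕ} (hnodup : cols.Nodup)
    (hcols : ∀ k < 22, ∀ l < 22, k + l < 22 → 22 * k + l ∈ cols)
    {f : MvPolynomial (Fin 2) K} (hf : f.totalDegree ≤ 21) :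
    f = (cols.map fun t => monomial (expo t) (coeff (expo t) f)).sum := by
  have hinj : Function.Injective expo := by
    intro s t h
    have h0 := DFunLike.congr_fun h 0
    have h1 := DFunLike.congr_fun h 1
    simp [expo] at h0 h1
    omega
  have hsub : f.support ⊆ cols.toFinset.image expo := by
    intro s hs
    have h := (le_totalDegree hs).trans hf
    rw [Finsupp.sum_fintype _ _ (by simp), Fin.sum_univ_two] at h
    refine Finset.mem_image.mpr ⟨22 * s 0 + s 1, List.mem_toFinset.mpr
      (hcols _ (by omega) _ (by omega) (by omega)), ?_⟩
    ext x
    fin_cases x <;> simp [expo] <;> omega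
  conv_lhs => rw [f.as_sum]
  rw [Finset.sum_subset hsub fun s _ hs => by rw [notMem_support_iff.mp hs, map_zero],
    Finset.sum_image hinj.injOn, List.sum_toFinset _ hnodup]

theorem sum_monomialDeriv_eq_zero {cols : List ℕ} (hnodup : cols.Nodup)
    (hcols : ∀ k < 22, ∀ l < 22, k + l < 22 → 22 * k + l ∈ cols)
    {f : MvPolynomial (Fin 2) ℂ} (hf : f.totalDegree ≤ 21) {a b m i j : ℕ} (hij : i + j < m)
    (hm : f ∈ ptIdeal (a, b) ^ m) :
    (cols.map fun t => (monomialDeriv a b i j t : ℂ) * coeff (expo t) f).sum = 0 := by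
  obtain ⟨n, rfl⟩ : ∃ n, m = n + 1 + i + j := ⟨m - (i + j) - 1, by omega⟩
  have hmem : (pderiv 0)^[i] ((pderiv 1)^[j] f) ∈ ptIdeal (a, b) :=
    Ideal.pow_le_self n.succ_ne_zero
      (iterate_derivation_mem_pow _ i (iterate_derivation_mem_pow _ j hm))
  have hle : ptIdeal (a, b) ≤ RingHom.ker (eval ![(a : ℂ), (b : ℂ)]) := by
    rw [ptIdeal, Ideal.span_le]
    rintro g (rfl | rfl) <;> simp
  have h0 : eval ![(a : ℂ), (b : ℂ)] ((pderiv 0)^[i] ((pderiv 1)^[j] f)) = 0 := hle hmem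
  let L : MvPolynomial (Fin 2) ℂ →ₗ[ℂ] ℂ :=
    (aeval ![(a : ℂ), (b : ℂ)]).toLinearMap ∘ₗ
      ((pderiv 0).toLinearMap ^ i) ∘ₗ ((pderiv 1).toLinearMap ^ j)
  have hL (g : MvPolynomial (Fin 2) ℂ) :
      L g = eval ![(a : ℂ), (b : ℂ)] ((pderiv 0)^[i] ((pderiv 1)^[j] g)) := by
    simp only [L, LinearMap.comp_apply, Module.End.pow_apply]
    rfl
  rw [← hL, eq_sum_monomial_expo hnodup hcols hf, map_list_sum, List.map_map] at h0
  rw [← h0]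
  congr 2
  funext t
  rw [Function.comp_apply, hL, eval_iterate_pderiv_monomial]

/-! ### The interpolation matrix -/

/-- The packed row of a derivative condition `(a, b, i, j)`. -/
def conditionRow (p B : ℕ) (cols : List ℕ) (x : ℕ × ℕ × ℕ × ℕ) : ℕ :=
  force x.1 fun a => force x.2.1 fun b => force x.2.2.1 fun i => force x.2.2.2 fun j =>
    pack B (fun t => Nat.mod (monomialDeriv a b i j t) p) cols

theorem conditionRow_eq (p B : ℕ) (cols : List ℕ) (a b i j : ℕ) :
    conditionRow p B cols (a, b, i, j) = pack B (fun t => monomialDeriv a b i j t % p) cols := rfl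

/-- Points with natural coordinates, and their multiplicities. -/
def fatPoints : List ((ℕ × ℕ) × ℕ) :=
  [((2, 9), 1), ((1, 4), 6), ((1, 7), 6), ((7, 7), 6), ((6, 3), 6), ((0, 6), 7), ((6, 9), 7),
    ((0, 7), 7), ((4, 3), 7), ((9, 1), 7), ((5, 0), 7)]

/-- The derivative conditions `(a, b, i, j)` imposed by `fatPoints`. -/
def conditions : List (ℕ × ℕ × ℕ × ℕ) :=
  fatPoints.flatMap fun x => (List.range x.2).flatMap fun i =>
    (List.range (x.2 - i)).map fun j => (x.1.1, x.1.2, i, j)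

/-- The indices of the monomials of degree at most `21`, in the order in which they serve as
pivots for `conditions` modulo `31`. -/
def pivots : List ℕ :=
  [0, 1, 22, 2, 3, 4, 5, 23, 44, 24, 25, 26, 45, 66, 46, 47, 67, 88, 68, 89, 110, 6, 27, 7,
   8, 9, 10, 11, 48, 28, 29, 30, 31, 69, 49, 50, 51, 90, 70, 71, 111, 91, 132, 112, 133, 154,
   92, 113, 72, 134, 155, 176, 93, 114, 135, 156, 177, 52, 198, 73, 199, 220, 32, 242, 94,
   115, 157, 136, 178, 53, 74, 116, 95, 137, 158, 179, 12, 200, 221, 33, 54, 75, 96, 117, 138,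
   159, 180, 201, 222, 243, 264, 13, 34, 55, 76, 97, 118, 139, 160, 181, 202, 223, 244, 14,
   35, 56, 77, 98, 119, 140, 15, 36, 57, 265, 286, 161, 182, 203, 224, 78, 245, 266, 287, 308,
   99, 120, 141, 162, 183, 204, 225, 246, 267, 288, 309, 330, 16, 37, 58, 79, 100, 121, 142,
   163, 184, 205, 226, 247, 268, 289, 310, 331, 352, 17, 38, 59, 101, 80, 122, 143, 164, 185,
   206, 227, 248, 269, 374, 290, 396, 311, 332, 353, 18, 39, 60, 81, 123, 102, 144, 165, 186,
   207, 228, 249, 270, 291, 312, 333, 354, 375, 19, 40, 61, 82, 103, 124, 20, 145, 166, 208,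
   187, 229, 250, 271, 292, 313, 334, 355, 376, 397, 418, 41, 62, 83, 104, 125, 146, 167, 188,
   230, 209, 251, 272, 293, 314, 335, 356, 377, 398, 419, 440, 21, 42, 63, 84, 105, 126, 147,
   168, 189, 210, 231, 252, 273, 294, 315, 336, 357, 378, 399, 420, 441, 462]

theorem pivots_nodup : pivots.Nodup := by decide +kernel

theorem mem_pivots : ∀ k < 22, ∀ l < 22, k + l < 22 → 22 * k + l ∈ pivots := by decide +kernel

theorem eliminates_pivots :
    eliminates 31 262144 pivots (conditions.map (conditionRow 31 262144 pivots)) = true := by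
  decide +kernel

theorem eq_zero_of_conditions_mod (v : ℕ → ZMod 31)
    (hv : ∀ x ∈ conditions, (pivots.map fun t =>
      (monomialDeriv x.1 x.2.1 x.2.2.1 x.2.2.2 t : ZMod 31) * v t).sum = 0) :
    ∀ t ∈ pivots, v t = 0 := by
  have : Fact (Nat.Prime 31) := ⟨by norm_num⟩
  have hd (a b i j t : ℕ) : digit 262144 (conditionRow 31 262144 pivots (a, b, i, j)) t =
      if t ∈ pivots then monomialDeriv a b i j t % 31 else 0 := by
    rw [conditionRow_eq]
    exact digit_pack (fun t => by omega) pivots_nodup t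
  refine eq_zero_of_eliminates (b := 31) pivots_nodup ?_ (by decide +kernel) eliminates_pivots ?_
  · rw [List.forall_mem_map]
    rintro ⟨a, b, i, j⟩ - t
    rw [hd]
    split_ifs <;> omega
  · rw [List.forall_mem_map]
    rintro ⟨a, b, i, j⟩ hx
    rw [← hv _ hx, pairing]
    congr 1
    refine List.map_congr_left fun t ht => ?_
    rw [hd, if_pos ht, ZMod.natCast_mod]

theorem eq_zero_of_mem_fatPoints {f : MvPolynomial (Fin 2) ℂ} (hf : f.totalDegree ≤ 21)
    (h : ∀ x ∈ fatPoints, f ∈ ptIdeal (x.1.1, x.1.2) ^ x.2) : f = 0 := by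
  have : Fact (Nat.Prime 31) := ⟨by norm_num⟩
  have hz := eq_zero_of_eq_zero_mod (by decide +kernel : conditions.length = pivots.length)
    pivots_nodup (fun x t => monomialDeriv x.1 x.2.1 x.2.2.1 x.2.2.2 t) eq_zero_of_conditions_mod
    (v := fun t => coeff (expo t) f) fun x hx => by
      simp only [conditions, List.mem_flatMap, List.mem_map, List.mem_range] at hx
      obtain ⟨y, hy, i, hi, j, hj, rfl⟩ := hx
      exact sum_monomialDeriv_eq_zero pivots_nodup mem_pivots hf (m := y.2) (i := i) (j := j)
        (by omega) (h y hy)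
  rw [eq_sum_monomial_expo pivots_nodup mem_pivots hf]
  refine List.sum_eq_zero fun g hg => ?_
  obtain ⟨t, ht, rfl⟩ := List.mem_map.mp hg
  rw [hz t ht, map_zero]

end FatPoints

theorem L21_1_6p4_7p6_empty :
    ∃ (p : ℂ × ℂ) (q : Fin 4 → ℂ × ℂ) (r : Fin 6 → ℂ × ℂ),
      ∀ f : MvPolynomial (Fin 2) ℂ, f.totalDegree ≤ 21 →
        f ∈ ptIdeal p → (∀ i, f ∈ ptIdeal (q i) ^ 6) → (∀ i, f ∈ ptIdeal (r i) ^ 7) → f = 0 := by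
  refine ⟨(2, 9), ![(1, 4), (1, 7), (7, 7), (6, 3)],
    ![(0, 6), (6, 9), (0, 7), (4, 3), (9, 1), (5, 0)], fun f hf hp hq hr => ?_⟩
  apply FatPoints.eq_zero_of_mem_fatPoints hf
  simpa [FatPoints.fatPoints, hp] using
    ⟨hq 0, hq 1, hq 2, hq 3, hr 0, hr 1, hr 2, hr 3, hr 4, hr 5⟩
end

section
/- There exist points p, q_1, q_2, r_1, …, r_7 ∈ ℂ² such that the only polynomial f ∈ ℂ[x,y] of total degree at most 21 that vanishes to order at least 5 at p, to order at least 6 at q_1 and q_2, and to order at least 7 at each r_i is the zero polynomial. (The linear system L_21(5, 6^2, 7^7) is empty and non-special; note C(23,2) = C(6,2) + 2·C(7,2) + 7·C(8,2) = 253.) -/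
open MvPolynomial

/-- `strict x f = f x`, but kernel reduction evaluates `x` to a literal before calling `f`. -/
def strict {α : Type} (x : ℕ) (f : ℕ → α) : α :=
  match x with
  | 0 => f 0
  | n + 1 => f (Nat.succ n)

/-- `strictMap f l acc k` passes the evaluated list `(l.map f).reverse ++ acc` to `k`. -/
def strictMap {α : Type} (f : α → ℕ) : List α → List ℕ → (List ℕ → Bool) → Bool
  | [], acc, k => k acc
  | a :: l, acc, k => strict (f a) fun x => strictMap f l (x :: acc) k

/-- Replaces each base-`65536` digit `d` selected by the masks by `d % 128 + d / 128`, which is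
congruent to `d` modulo `127`. -/
def fold127 (lo hi R : ℕ) : ℕ := Nat.add (Nat.land R lo) (Nat.land (Nat.div R 128) hi)

/-- The number with `n` base-`65536` digits, all equal to `1`. -/
def rep : ℕ → ℕ
  | 0 => 0
  | n + 1 => 1 + 65536 * rep n

/-- The lowest base-`65536` digit of `R`, reduced modulo `127`. -/
def digit (R : ℕ) : ℕ := Nat.mod (Nat.mod R 65536) 127

/-- Eliminates the leading entry of the packed row `R` by the pivot row `P`, modulo `127`, and
drops it. -/
def clearRow (lo hi P R : ℕ) : ℕ :=
  strict (digit R) fun r =>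
  bif Nat.beq r 0 then Nat.div R 65536
  else strict (fold127 lo hi
      (Nat.div (Nat.add (Nat.mul (digit P) R) (Nat.mul (Nat.sub 127 r) P)) 65536))
    (fold127 lo hi)

/-- Passes the first row with nonzero leading entry, and the list of the other rows, to `k`. -/
def findPivot : List ℕ → List ℕ → (ℕ → List ℕ → Bool) → Bool
  | _, [], _ => false
  | acc, R :: rows, k =>
    bif Nat.beq (digit R) 0 then findPivot (R :: acc) rows k else k R (acc.reverseAux rows)

/-- Gaussian elimination modulo `127` on packed rows of length `n`: decides whether the rows have
rank `n`. -/
def eliminate : ℕ → ℕ → ℕ → List ℕ → Bool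
  | 0, _, _, _ => true
  | n + 1, lo, hi, rows =>
    strict (Nat.div lo 65536) fun lo' => strict (Nat.div hi 65536) fun hi' =>
      findPivot [] rows fun P rest =>
        strictMap (clearRow lo' hi' P) rest [] fun rows' => eliminate n lo' hi' rows'

/-- The residue modulo `127` of the coefficient of `(x - u) ^ i` in the expansion of `x ^ a`. -/
def taylor (u i a : ℕ) : ℕ := a.descFactorial i / i.factorial * u ^ (a - i) % 127

/-- Packs `taylor u i a` for `a = n - 1, …, 0`. -/
def packTaylor (u i : ℕ) : ℕ → ℕ
  | 0 => 0
  | n + 1 => taylor u i n + 65536 * packTaylor u i n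

/-- Packs `taylor u i a * taylor v j c` for `a + c ≤ 21` and `c < b`, in decreasing order of
`c` and then of `a`, where `A = packTaylor u i 22`. -/
def packRow (A v j : ℕ) : ℕ → ℕ
  | 0 => 0
  | b + 1 => taylor v j b * (A / 65536 ^ b) + 65536 ^ (22 - b) * packRow A v j b

/-- The packed row of the condition `c = (u, v, i, j)`: the coefficient of
`(x - u) ^ i * (y - v) ^ j` vanishes. -/
def condRow (lo hi : ℕ) (c : ℕ × ℕ × ℕ × ℕ) : ℕ :=
  strict (packTaylor c.1 c.2.2.1 22) fun A =>
  strict (packRow A c.2.1 c.2.2.2 22) fun R =>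
  strict (fold127 lo hi R) (fold127 lo hi)

/-- The points `(u, v)` with their multiplicities `m`, as triples `(u, v, m)`. -/
def points : List (ℕ × ℕ × ℕ) :=
  [(5, 1, 7), (6, 8, 7), (3, 7, 7), (7, 3, 7), (6, 5, 7), (7, 6, 7), (8, 7, 7),
    (6, 2, 6), (5, 2, 6), (1, 2, 5)]

/-- All vanishing conditions `(u, v, i, j)` imposed at `points`. -/
def conds : List (ℕ × ℕ × ℕ × ℕ) :=
  points.flatMap fun P => (List.range P.2.2).flatMap fun i =>
    (List.range (P.2.2 - i)).map fun j => (P.1, P.2.1, i, j)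

/-- Checks that the vanishing conditions at `points` are independent modulo `127`. -/
def certificate : Bool :=
  strict (127 * rep 253) fun lo => strict (511 * rep 253) fun hi =>
    strictMap (condRow lo hi) conds [] fun rows => eliminate 253 lo hi rows

theorem strict_eq {α : Type} (x : ℕ) (f : ℕ → α) : strict x f = f x := by
  cases x <;> rfl

theorem strictMap_eq {α : Type} (f : α → ℕ) (l : List α) (acc : List ℕ) (k : List ℕ → Bool) :
    strictMap f l acc k = k ((l.map f).reverse ++ acc) := by
  induction l generalizing acc with
  | nil => rfl
  | cons a l ih => simp [strictMap, strict_eq, ih]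

/-- The linear form with coefficient vector packed in `R`, evaluated at `cs`. -/
def packedEval {K : Type*} [CommRing K] : List K → ℕ → K
  | [], _ => 0
  | c :: cs, R => ((R % 65536 : ℕ) : K) * c + packedEval cs (R / 65536)

/-- The `n` lowest base-`65536` digits of `R` are at most `K`. -/
def DigitsLE (K : ℕ) : ℕ → ℕ → Prop
  | 0, _ => True
  | n + 1, R => R % 65536 ≤ K ∧ DigitsLE K n (R / 65536)

theorem DigitsLE.mono {K L n R : ℕ} (hKL : K ≤ L) (h : DigitsLE K n R) : DigitsLE L n R := by
  induction n generalizing R with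
  | zero => trivial
  | succ n ih => exact ⟨h.1.trans hKL, ih h.2⟩

theorem digitsLE_max (n R : ℕ) : DigitsLE 65535 n R := by
  induction n generalizing R with
  | zero => trivial
  | succ n ih => exact ⟨by omega, ih _⟩

theorem DigitsLE.add {K L n x y : ℕ} (hx : DigitsLE K n x) (hy : DigitsLE L n y)
    (h : K + L < 65536) : DigitsLE (K + L) n (x + y) := by
  induction n generalizing x y with
  | zero => trivial
  | succ n ih =>
    obtain ⟨hx, hx'⟩ := hx
    obtain ⟨hy, hy'⟩ := hy
    refine ⟨by omega, ?_⟩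
    rw [show (x + y) / 65536 = x / 65536 + y / 65536 by omega]
    exact ih hx' hy'

theorem mul_mod_div_of_digit {K s x : ℕ} (hx : x % 65536 ≤ K) (h : s * K < 65536) :
    s * x % 65536 = s * (x % 65536) ∧ s * x / 65536 = s * (x / 65536) := by
  have h1 : s * (x % 65536) ≤ s * K := Nat.mul_le_mul_left s hx
  have h2 : s * x = 65536 * (s * (x / 65536)) + s * (x % 65536) := by
    conv_lhs => rw [← Nat.div_add_mod x 65536]
    ring
  omega

theorem DigitsLE.mul {K n s x : ℕ} (hx : DigitsLE K n x) (h : s * K < 65536) :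
    DigitsLE (s * K) n (s * x) := by
  induction n generalizing x with
  | zero => trivial
  | succ n ih =>
    obtain ⟨hx, hx'⟩ := hx
    obtain ⟨h1, h2⟩ := mul_mod_div_of_digit hx h
    refine ⟨?_, ?_⟩
    · rw [h1]
      exact Nat.mul_le_mul_left s hx
    · rw [h2]
      exact ih hx'

section packedEval

variable {F : Type*} [CommRing F]

theorem packedEval_add {K L x y : ℕ} (cs : List F) (hx : DigitsLE K cs.length x)
    (hy : DigitsLE L cs.length y) (h : K + L < 65536) :
    packedEval cs (x + y) = packedEval cs x + packedEval cs y := by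
  induction cs generalizing x y with
  | nil => simp [packedEval]
  | cons c cs ih =>
    obtain ⟨hx, hx'⟩ := hx
    obtain ⟨hy, hy'⟩ := hy
    simp only [packedEval]
    rw [show (x + y) / 65536 = x / 65536 + y / 65536 by omega,
      show (x + y) % 65536 = x % 65536 + y % 65536 by omega, ih hx' hy']
    push_cast
    ring

theorem packedEval_mul {K s x : ℕ} (cs : List F) (hx : DigitsLE K cs.length x)
    (h : s * K < 65536) : packedEval cs (s * x) = s * packedEval cs x := by
  induction cs generalizing x with
  | nil => simp [packedEval]
  | cons c cs ih =>
    obtain ⟨hx, hx'⟩ := hx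
    obtain ⟨h1, h2⟩ := mul_mod_div_of_digit hx h
    simp only [packedEval, h1, h2, ih hx']
    push_cast
    ring

theorem packedEval_append {x : ℕ} (cs ds : List F) (y : ℕ) (hx : x < 65536 ^ cs.length) :
    packedEval (cs ++ ds) (x + 65536 ^ cs.length * y) = packedEval cs x + packedEval ds y := by
  induction cs generalizing x with
  | nil =>
    have : x = 0 := by simpa using hx
    simp [packedEval, this]
  | cons c cs ih =>
    have hx' : x / 65536 < 65536 ^ cs.length := by
      rw [List.length_cons, pow_succ] at hx
      exact Nat.div_lt_of_lt_mul (by rwa [mul_comm])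
    have h : x + 65536 ^ (c :: cs).length * y = x + 65536 * (65536 ^ cs.length * y) := by
      rw [List.length_cons, pow_succ]
      ring
    rw [h, List.cons_append, packedEval, packedEval, Nat.add_mul_mod_self_left,
      Nat.add_mul_div_left _ _ (by norm_num), ih hx', add_assoc]

end packedEval

theorem fold127_succ (n R : ℕ) :
    fold127 (127 * rep (n + 1)) (511 * rep (n + 1)) R % 65536
        = R % 65536 % 128 + R % 65536 / 128 ∧
      fold127 (127 * rep (n + 1)) (511 * rep (n + 1)) R / 65536
        = fold127 (127 * rep n) (511 * rep n) (R / 65536) := by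
  have mask (d x : ℕ) (hd : d < 65536) : (x &&& d * rep (n + 1)) % 65536 = (x % 65536) &&& d ∧
      (x &&& d * rep (n + 1)) / 65536 = (x / 65536) &&& d * rep n := by
    have h1 : d * rep (n + 1) % 2 ^ 16 = d := by simp only [rep]; grind
    have h2 : d * rep (n + 1) / 2 ^ 16 = d * rep n := by simp only [rep]; grind
    constructor
    · rw [show 65536 = 2 ^ 16 by norm_num, Nat.and_mod_two_pow, h1]
    · rw [show 65536 = 2 ^ 16 by norm_num, Nat.and_div_two_pow, h2]
  have e (lo hi x : ℕ) : fold127 lo hi x = (x &&& lo) + (x / 128 &&& hi) := rfl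
  obtain ⟨h1, h2⟩ := mask 127 R (by norm_num)
  obtain ⟨h3, h4⟩ := mask 511 (R / 128) (by norm_num)
  rw [show 127 = 2 ^ 7 - 1 by norm_num, Nat.and_two_pow_sub_one_eq_mod] at h1
  rw [show 511 = 2 ^ 9 - 1 by norm_num, Nat.and_two_pow_sub_one_eq_mod] at h3
  norm_num at h1 h3
  have h5 : R % 65536 / 128 = R / 128 % 512 := by omega
  have h6 : R % 65536 % 128 = R % 128 := by omega
  rw [e, e, h5, h6]
  have h7 : R / 128 % 512 < 512 := Nat.mod_lt _ (by norm_num)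
  have h8 : R % 128 < 128 := Nat.mod_lt _ (by norm_num)
  generalize R / 128 % 512 = s at *
  refine ⟨by omega, ?_⟩
  rw [← show R / 128 / 65536 = R / 65536 / 128 by omega, ← h2, ← h4]
  omega

theorem DigitsLE.fold127 {K n R : ℕ} (h : DigitsLE K n R) :
    DigitsLE (127 + K / 128) n (fold127 (127 * rep n) (511 * rep n) R) := by
  induction n generalizing R with
  | zero => trivial
  | succ n ih =>
    obtain ⟨h1, h2⟩ := fold127_succ n R
    obtain ⟨h, h'⟩ := h
    exact ⟨by omega, h2 ▸ ih h'⟩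

theorem digitsLE_fold127_fold127 (n R : ℕ) :
    DigitsLE 131 n (fold127 (127 * rep n) (511 * rep n)
      (fold127 (127 * rep n) (511 * rep n) R)) :=
  (digitsLE_max n R).fold127.fold127

theorem packedEval_fold127 (cs : List (ZMod 127)) (R : ℕ) :
    packedEval cs (fold127 (127 * rep cs.length) (511 * rep cs.length) R) = packedEval cs R := by
  induction cs generalizing R with
  | nil => rfl
  | cons c cs ih =>
    obtain ⟨h1, h2⟩ := fold127_succ cs.length R
    rw [packedEval, packedEval, List.length_cons, h1, h2, ih]
    congr 2
    rw [ZMod.natCast_eq_natCast_iff']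
    omega

theorem digit_cast (R : ℕ) : (digit R : ZMod 127) = (R % 65536 : ℕ) := by
  rw [ZMod.natCast_eq_natCast_iff']
  exact Nat.mod_mod _ _

theorem digit_lt (R : ℕ) : digit R < 127 := Nat.mod_lt _ (by norm_num)

theorem clearRow_eq (lo hi P R : ℕ) : clearRow lo hi P R = if digit R = 0 then R / 65536 else
    fold127 lo hi (fold127 lo hi ((digit P * R + (127 - digit R) * P) / 65536)) := by
  unfold clearRow
  simp only [strict_eq]
  by_cases h : digit R = 0
  · simp [h]
    rfl
  · rw [if_neg h, show Nat.beq (digit R) 0 = false by rwa [← Bool.not_eq_true, Nat.beq_eq]]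
    rfl

theorem digitsLE_clearRow {n P R : ℕ} (hR : DigitsLE 131 (n + 1) R) :
    DigitsLE 131 n (clearRow (127 * rep n) (511 * rep n) P R) := by
  rw [clearRow_eq]
  split_ifs
  · exact hR.2
  · exact digitsLE_fold127_fold127 _ _

theorem packedEval_clearRow {P R : ℕ} (c : ZMod 127) (cs : List (ZMod 127))
    (hP : DigitsLE 131 (cs.length + 1) P) (hR : DigitsLE 131 (cs.length + 1) R)
    (hP0 : packedEval (c :: cs) P = 0) (hR0 : packedEval (c :: cs) R = 0) :
    packedEval cs (clearRow (127 * rep cs.length) (511 * rep cs.length) P R) = 0 := by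
  rw [clearRow_eq]
  split_ifs with h
  · rw [packedEval, ← digit_cast, h] at hR0
    simpa using hR0
  · rw [packedEval_fold127, packedEval_fold127]
    have hp := digit_lt P
    have hr := digit_lt R
    have h1 : DigitsLE (126 * 131) (cs.length + 1) (digit P * R) :=
      (hR.mul (by omega)).mono (by omega)
    have h2 : DigitsLE (127 * 131) (cs.length + 1) ((127 - digit R) * P) :=
      (hP.mul (by omega)).mono (by omega)
    have key : packedEval (c :: cs) (digit P * R + (127 - digit R) * P) = 0 := by
      rw [packedEval_add (c :: cs) h1 h2 (by norm_num),
        packedEval_mul (c :: cs) hR (by omega), packedEval_mul (c :: cs) hP (by omega), hP0, hR0]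
      simp
    have hd : ((digit P * R + (127 - digit R) * P) % 65536 : ℕ) =
        digit P * (R % 65536) + (127 - digit R) * (P % 65536) := by
      have e1 := (mul_mod_div_of_digit (s := digit P) hR.1 (by omega)).1
      have e2 := (mul_mod_div_of_digit (s := 127 - digit R) hP.1 (by omega)).1
      have b1 := h1.1
      have b2 := h2.1
      omega
    rw [packedEval, hd] at key
    have h127 : (127 : ZMod 127) = 0 := rfl
    push_cast [Nat.cast_sub hr.le] at key
    rw [h127, digit_cast, digit_cast] at key
    linear_combination key

theorem exists_of_findPivot {acc rows : List ℕ} {k : ℕ → List ℕ → Bool}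
    (h : findPivot acc rows k = true) :
    ∃ P rest, digit P ≠ 0 ∧ (∀ R ∈ P :: rest, R ∈ acc ∨ R ∈ rows) ∧ k P rest = true := by
  induction rows generalizing acc with
  | nil => simp [findPivot] at h
  | cons R rows ih =>
    rw [findPivot] at h
    by_cases hR : digit R = 0
    · rw [hR] at h
      obtain ⟨P, rest, hP, hmem, hk⟩ := ih h
      refine ⟨P, rest, hP, fun S hS => ?_, hk⟩
      have := hmem S hS
      grind
    · rw [show Nat.beq (digit R) 0 = false by rwa [← Bool.not_eq_true, Nat.beq_eq]] at h
      refine ⟨R, _, hR, fun S hS => ?_, h⟩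
      simp only [List.reverseAux_eq, List.mem_cons, List.mem_append, List.mem_reverse] at hS ⊢
      tauto

theorem eq_zero_of_eliminate (cs : List (ZMod 127)) (rows : List ℕ)
    (h : eliminate cs.length (127 * rep cs.length) (511 * rep cs.length) rows = true)
    (hbd : ∀ R ∈ rows, DigitsLE 131 cs.length R) (hrows : ∀ R ∈ rows, packedEval cs R = 0) :
    ∀ c ∈ cs, c = 0 := by
  induction cs generalizing rows with
  | nil => simp
  | cons c cs ih =>
    have hmask (d : ℕ) (hd : d < 65536) :
        Nat.div (d * rep (cs.length + 1)) 65536 = d * rep cs.length := by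
      change d * (1 + 65536 * rep cs.length) / 65536 = _
      grind
    rw [List.length_cons, eliminate, strict_eq, strict_eq, hmask 127 (by norm_num),
      hmask 511 (by norm_num)] at h
    obtain ⟨P, rest, hP, hmem, hk⟩ := exists_of_findPivot h
    replace hmem : ∀ R ∈ P :: rest, R ∈ rows := fun R hR => by simpa using hmem R hR
    have hPmem := hmem P List.mem_cons_self
    rw [strictMap_eq] at hk
    have hcs : ∀ d ∈ cs, d = 0 := by
      refine ih _ hk ?_ ?_
      · intro R hR
        simp only [List.append_nil, List.mem_reverse, List.mem_map] at hR
        obtain ⟨S, hS, rfl⟩ := hR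
        exact digitsLE_clearRow (hbd S (hmem S (List.mem_cons_of_mem _ hS)))
      · intro R hR
        simp only [List.append_nil, List.mem_reverse, List.mem_map] at hR
        obtain ⟨S, hS, rfl⟩ := hR
        have hS' := hmem S (List.mem_cons_of_mem _ hS)
        exact packedEval_clearRow c cs (hbd P hPmem) (hbd S hS') (hrows P hPmem) (hrows S hS')
    have hzero (ds : List (ZMod 127)) (hds : ∀ d ∈ ds, d = 0) (R : ℕ) : packedEval ds R = 0 := by
      induction ds generalizing R with
      | nil => rfl
      | cons d ds ih =>
        rw [packedEval, hds d List.mem_cons_self, ih fun e he => hds e (List.mem_cons_of_mem _ he)]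
        simp
    have hc := hrows P hPmem
    rw [packedEval, hzero cs hcs, add_zero, ← digit_cast] at hc
    have : Fact (Nat.Prime 127) := ⟨by norm_num⟩
    have hP' : (digit P : ZMod 127) ≠ 0 := by
      rw [Ne, ZMod.natCast_eq_zero_iff]
      exact Nat.not_dvd_of_pos_of_lt (Nat.pos_of_ne_zero hP) (digit_lt P)
    intro d hd
    rcases List.mem_cons.1 hd with rfl | hd
    · exact (mul_eq_zero.1 hc).resolve_left hP'
    · exact hcs d hd

/-- The exponents `(a, c)` with `a + c ≤ 21` and `c < b`, in the order used by `packRow`. -/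
def monomials : ℕ → List (ℕ × ℕ)
  | 0 => []
  | b + 1 => (List.range (22 - b)).reverse.map (fun a => (a, b)) ++ monomials b

theorem mem_monomials {b : ℕ} {s : ℕ × ℕ} :
    s ∈ monomials b ↔ s.2 < b ∧ s.1 + s.2 ≤ 21 := by
  induction b with
  | zero => simp [monomials]
  | succ b ih =>
    obtain ⟨a, c⟩ := s
    simp only [monomials, List.mem_append, List.mem_map, List.mem_reverse, List.mem_range, ih,
      Prod.mk.injEq]
    constructor
    · rintro (⟨a', h, rfl, rfl⟩ | h) <;> omega
    · rintro ⟨h1, h2⟩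
      by_cases h : c = b
      · exact Or.inl ⟨a, by omega, rfl, h.symm⟩
      · omega

theorem nodup_monomials (b : ℕ) : (monomials b).Nodup := by
  induction b with
  | zero => exact List.nodup_nil
  | succ b ih =>
    refine List.Nodup.append ?_ ih ?_
    · exact (List.nodup_reverse.2 List.nodup_range).map fun a a' h => (Prod.mk.inj h).1
    · intro s hs hs'
      simp only [List.mem_map] at hs
      obtain ⟨a, -, rfl⟩ := hs
      exact absurd (mem_monomials.1 hs').1 (lt_irrefl b)

theorem taylor_lt (u i a : ℕ) : taylor u i a < 127 := Nat.mod_lt _ (by norm_num)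

theorem taylor_cast (u i a : ℕ) :
    (taylor u i a : ZMod 127) = (a.choose i * u ^ (a - i) : ℕ) := by
  rw [taylor, ← Nat.choose_eq_descFactorial_div_factorial, ZMod.natCast_mod]

theorem mul_packTaylor_lt {k : ℕ} (hk : k < 127) (u i n : ℕ) :
    k * packTaylor u i n < 65536 ^ n := by
  induction n with
  | zero => simp [packTaylor]
  | succ n ih =>
    have h : k * taylor u i n ≤ 126 * 126 :=
      Nat.mul_le_mul (by omega) (Nat.le_of_lt_succ (taylor_lt u i n))
    rw [packTaylor, pow_succ, mul_add, mul_left_comm]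
    omega

theorem packTaylor_div (u i n b : ℕ) :
    packTaylor u i (n + b) / 65536 ^ b = packTaylor u i n := by
  induction b with
  | zero => simp
  | succ b ih =>
    have := taylor_lt u i (n + b)
    rw [← add_assoc, packTaylor, pow_succ', ← Nat.div_div_eq_div_mul,
      Nat.add_mul_div_left _ _ (by norm_num),
      Nat.div_eq_of_lt (this.trans (by norm_num)), zero_add, ih]

theorem digitsLE_packTaylor (u i n : ℕ) : DigitsLE 126 n (packTaylor u i n) := by
  induction n with
  | zero => trivial
  | succ n ih =>
    have := taylor_lt u i n
    refine ⟨by rw [packTaylor]; omega, ?_⟩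
    convert ih using 1
    simpa using packTaylor_div u i n 1

theorem packedEval_packTaylor (u i n : ℕ) (w : ℕ → ZMod 127) :
    packedEval ((List.range n).reverse.map w) (packTaylor u i n) =
      ((List.range n).reverse.map fun a => (taylor u i a : ZMod 127) * w a).sum := by
  induction n with
  | zero => rfl
  | succ n ih =>
    have h := taylor_lt u i n
    have h1 : packTaylor u i (n + 1) % 65536 = taylor u i n := by rw [packTaylor]; omega
    have h2 : packTaylor u i (n + 1) / 65536 = packTaylor u i n := by
      simpa using packTaylor_div u i n 1
    simp only [List.range_succ, List.reverse_append, List.reverse_singleton, List.singleton_append,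
      List.map_cons, List.sum_cons, packedEval, h1, h2, ih]

theorem packedEval_packRow (u v i j : ℕ) {b : ℕ} (hb : b ≤ 22) (w : ℕ × ℕ → ZMod 127) :
    packedEval ((monomials b).map w) (packRow (packTaylor u i 22) v j b) =
      ((monomials b).map fun s =>
        (taylor u i s.1 : ZMod 127) * (taylor v j s.2 : ZMod 127) * w s).sum := by
  induction b with
  | zero => rfl
  | succ b ih =>
    have hA : packTaylor u i 22 / 65536 ^ b = packTaylor u i (22 - b) := by
      conv_lhs => rw [show 22 = 22 - b + b by omega, packTaylor_div]
    have hv := taylor_lt v j b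
    have hdig := digitsLE_packTaylor u i (22 - b)
    have hlt : taylor v j b * packTaylor u i (22 - b) < 65536 ^ (22 - b) :=
      mul_packTaylor_lt hv u i _
    have happ := packedEval_append ((List.range (22 - b)).reverse.map fun a => w (a, b))
      ((monomials b).map w) (x := taylor v j b * packTaylor u i (22 - b))
      (packRow (packTaylor u i 22) v j b) (by simpa using hlt)
    have hmul := packedEval_mul ((List.range (22 - b)).reverse.map fun a => w (a, b))
      (x := packTaylor u i (22 - b)) (s := taylor v j b) (by simpa using hdig) (by omega)
    simp only [List.length_map, List.length_reverse, List.length_range] at happ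
    rw [packRow, hA, monomials, List.map_append, List.map_map, List.map_append, List.sum_append,
      ← ih (by omega), Function.comp_def, happ, hmul, packedEval_packTaylor,
      ← List.sum_map_mul_left, List.map_map, Function.comp_def]
    congr 3
    ext a
    ring

theorem condRow_eq (lo hi : ℕ) (c : ℕ × ℕ × ℕ × ℕ) : condRow lo hi c =
    fold127 lo hi (fold127 lo hi (packRow (packTaylor c.1 c.2.2.1 22) c.2.1 c.2.2.2 22)) := by
  simp only [condRow, strict_eq]

/-- The coefficient of `x ^ s.1 * y ^ s.2` in the Taylor condition `c`. -/
def condEntry (c : ℕ × ℕ × ℕ × ℕ) (s : ℕ × ℕ) : ℕ :=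
  s.1.choose c.2.2.1 * c.1 ^ (s.1 - c.2.2.1) * (s.2.choose c.2.2.2 * c.2.1 ^ (s.2 - c.2.2.2))

theorem certificate_eq_true : certificate = true := by decide +kernel

theorem length_monomials : (monomials 22).length = 253 := by decide +kernel

theorem length_conds : conds.length = 253 := by decide +kernel

theorem eq_zero_of_conds_zmod (w : ℕ × ℕ → ZMod 127)
    (hw : ∀ c ∈ conds, ((monomials 22).map fun s => (condEntry c s : ZMod 127) * w s).sum = 0) :
    ∀ s ∈ monomials 22, w s = 0 := by
  have hlen : ((monomials 22).map w).length = 253 := by rw [List.length_map, length_monomials]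
  have hcert := certificate_eq_true
  rw [certificate, strict_eq, strict_eq, strictMap_eq, List.append_nil, ← hlen] at hcert
  have := eq_zero_of_eliminate _ _ hcert ?_ ?_
  · exact fun s hs => this _ (List.mem_map_of_mem hs)
  · intro R hR
    simp only [List.mem_reverse, List.mem_map] at hR
    obtain ⟨c, -, rfl⟩ := hR
    rw [condRow_eq]
    exact digitsLE_fold127_fold127 _ _
  · intro R hR
    rw [List.mem_reverse, List.mem_map] at hR
    obtain ⟨c, hc, rfl⟩ := hR
    rw [condRow_eq, packedEval_fold127, packedEval_fold127, packedEval_packRow _ _ _ _ le_rfl,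
      ← hw c hc]
    simp only [taylor_cast, condEntry, Nat.cast_mul]

/-- The exponent vector of `x ^ s.1 * y ^ s.2`. -/
noncomputable def expo (s : ℕ × ℕ) : Fin 2 →₀ ℕ :=
  Finsupp.single 0 s.1 + Finsupp.single 1 s.2

theorem expo_injective : Function.Injective expo := by
  intro s t h
  have h0 := DFunLike.congr_fun h 0
  have h1 := DFunLike.congr_fun h 1
  simp [expo] at h0 h1
  exact Prod.ext h0 h1

theorem expo_apply (s : Fin 2 →₀ ℕ) : expo (s 0, s 1) = s := by
  ext i
  fin_cases i <;> simp [expo]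

/-- The substitution moving the point `p` to the origin. -/
noncomputable def recenter (p : ℂ × ℂ) : MvPolynomial (Fin 2) ℂ →ₐ[ℂ] MvPolynomial (Fin 2) ℂ :=
  aeval ![X 0 + C p.1, X 1 + C p.2]

theorem coeff_recenter_eq_zero {p : ℂ × ℂ} {m : ℕ} {f : MvPolynomial (Fin 2) ℂ}
    (hf : f ∈ ptIdeal p ^ m) {t : ℕ × ℕ} (ht : t.1 + t.2 < m) :
    coeff (expo t) (recenter p f) = 0 := by
  have hle : (ptIdeal p).map (recenter p) ≤ idealOfVars (Fin 2) ℂ := by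
    rw [ptIdeal, Ideal.map_span, Ideal.span_le]
    rintro _ ⟨g, hg, rfl⟩
    rcases hg with rfl | rfl
    · exact Ideal.subset_span ⟨0, by simp [recenter, ← algebraMap_eq]⟩
    · exact Ideal.subset_span ⟨1, by simp [recenter, ← algebraMap_eq]⟩
  have hmem : recenter p f ∈ idealOfVars (Fin 2) ℂ ^ m := by
    have := Ideal.mem_map_of_mem (recenter p) hf
    rw [Ideal.map_pow] at this
    exact Ideal.pow_right_mono hle m this
  refine (mem_pow_idealOfVars_iff' m _).1 hmem _ ?_
  simpa [expo, Finsupp.degree_single] using ht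

theorem X_add_C_pow (k : Fin 2) (u : ℂ) (a : ℕ) : (X k + C u) ^ a =
    ∑ i ∈ Finset.range (a + 1), monomial (Finsupp.single k i) (u ^ (a - i) * (a.choose i : ℂ)) := by
  rw [add_pow]
  refine Finset.sum_congr rfl fun i _ => ?_
  rw [X_pow_eq_monomial, ← C_pow, ← map_natCast (C (σ := Fin 2) (R := ℂ)), mul_assoc, ← C_mul,
    mul_comm, C_mul_monomial, mul_one]

theorem coeff_recenter_monomial (p : ℂ × ℂ) (s t : ℕ × ℕ) (c : ℂ) :
    coeff (expo t) (recenter p (monomial (expo s) c)) =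
      s.1.choose t.1 * p.1 ^ (s.1 - t.1) * (s.2.choose t.2 * p.2 ^ (s.2 - t.2)) * c := by
  have h : recenter p (monomial (expo s) c) =
      C c * ((X 0 + C p.1) ^ s.1 * (X 1 + C p.2) ^ s.2) := by
    rw [recenter, aeval_monomial, Finsupp.prod_fintype _ _ (by simp)]
    simp [expo, algebraMap_eq]
  have hexpo (i j : ℕ) : Finsupp.single (0 : Fin 2) i + Finsupp.single 1 j = expo (i, j) := rfl
  rw [h, coeff_C_mul, X_add_C_pow, X_add_C_pow, Finset.sum_mul_sum]
  simp only [monomial_mul, hexpo, coeff_sum, coeff_monomial, expo_injective.eq_iff]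
  obtain ⟨i, j⟩ := t
  simp only [Prod.mk.injEq, ite_and]
  simp only [Finset.sum_ite_irrel, Finset.sum_const_zero, Finset.sum_ite_eq', Finset.mem_range]
  split_ifs with h1 h2
  · ring
  · rw [Nat.choose_eq_zero_of_lt (by omega : s.2 < j)]
    simp
  · rw [Nat.choose_eq_zero_of_lt (by omega : s.1 < i)]
    simp

/-- A square integer linear system whose reduction modulo a prime has only the trivial solution
has only the trivial solution in characteristic zero. -/
theorem eq_zero_of_forall_sum_eq_zero_of_zmod {ρ κ K : Type} [Field K] [CharZero K]
    {p : ℕ} [Fact p.Prime] {rows : List ρ} {cols : List κ} (hcols : cols.Nodup)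
    (hlen : rows.length = cols.length) (e : ρ → κ → ℕ)
    (hp : ∀ w : κ → ZMod p, (∀ r ∈ rows, (cols.map fun x => (e r x : ZMod p) * w x).sum = 0) →
      ∀ x ∈ cols, w x = 0)
    (w : κ → K) (hw : ∀ r ∈ rows, (cols.map fun x => (e r x : K) * w x).sum = 0) :
    ∀ x ∈ cols, w x = 0 := by
  let M : Matrix (Fin cols.length) (Fin cols.length) ℤ :=
    Matrix.of fun i k => e (rows[i.1]'(hlen.symm ▸ i.2)) cols[k.1]
  have hM (A : Type) [CommRing A] (v : κ → A) (i : Fin cols.length) :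
      ((Int.castRingHom A).mapMatrix M).mulVec (fun k => v cols[k.1]) i =
        (cols.map fun x => (e (rows[i.1]'(hlen.symm ▸ i.2)) x : A) * v x).sum := by
    rw [← Fin.sum_univ_fun_getElem]
    simp [Matrix.mulVec, dotProduct, M]
  have hdet : M.det ≠ 0 := by
    intro h0
    have h1 : ((Int.castRingHom (ZMod p)).mapMatrix M).det = 0 := by
      rw [← RingHom.map_det, h0, map_zero]
    obtain ⟨v, hv, hMv⟩ := Matrix.exists_mulVec_eq_zero_iff.2 h1
    have hinj : Function.Injective fun k : Fin cols.length => cols[k.1] :=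
      fun a b h => Fin.ext ((hcols.getElem_inj_iff).1 h)
    let w' := Function.extend (fun k : Fin cols.length => cols[k.1]) v 0
    have hw' (k : Fin cols.length) : w' cols[k.1] = v k := hinj.extend_apply v 0 k
    refine hv (funext fun k => ?_)
    rw [← hw' k]
    refine hp w' (fun r hr => ?_) _ (List.getElem_mem _)
    obtain ⟨i, hi, rfl⟩ := List.getElem_of_mem hr
    have := hM _ w' ⟨i, hlen ▸ hi⟩
    simp only [hw', hMv] at this
    exact this.symm
  have hker : (fun k : Fin cols.length => w cols[k.1]) = 0 := by
    by_contra hne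
    have h0 := Matrix.exists_mulVec_eq_zero_iff.1 ⟨_, hne, funext fun i => by
      rw [hM K w i, hw _ (List.getElem_mem _), Pi.zero_apply]⟩
    rw [← RingHom.map_det] at h0
    exact hdet (by simpa using h0)
  intro x hx
  obtain ⟨k, hk, rfl⟩ := List.getElem_of_mem hx
  exact congr_fun hker ⟨k, hk⟩

theorem eq_sum_monomials {f : MvPolynomial (Fin 2) ℂ} (hf : f.totalDegree ≤ 21) :
    f = ((monomials 22).map fun s => monomial (expo s) (coeff (expo s) f)).sum := by
  classical
  rw [← List.sum_toFinset _ (nodup_monomials 22)]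
  ext t
  obtain ⟨s, rfl⟩ : ∃ s, expo s = t := ⟨_, expo_apply t⟩
  simp only [coeff_sum, coeff_monomial, expo_injective.eq_iff, Finset.sum_ite_eq',
    List.mem_toFinset, mem_monomials]
  split_ifs with h
  · rfl
  · refine coeff_eq_zero_of_totalDegree_lt (hf.trans_lt ?_)
    change 21 < (expo s).degree
    simp only [expo, map_add, Finsupp.degree_single]
    omega

theorem eq_zero_of_mem_ptIdeal {f : MvPolynomial (Fin 2) ℂ} (hdeg : f.totalDegree ≤ 21)
    (hf : ∀ P ∈ points, f ∈ ptIdeal ((P.1 : ℂ), (P.2.1 : ℂ)) ^ P.2.2) : f = 0 := by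
  have : Fact (Nat.Prime 127) := ⟨by norm_num⟩
  have hcoeff : ∀ s ∈ monomials 22, coeff (expo s) f = 0 := by
    refine eq_zero_of_forall_sum_eq_zero_of_zmod (nodup_monomials 22)
      (length_conds.trans length_monomials.symm) condEntry eq_zero_of_conds_zmod _ ?_
    intro c hc
    simp only [conds, List.mem_flatMap, List.mem_map, List.mem_range] at hc
    obtain ⟨P, hP, i, hi, j, hj, rfl⟩ := hc
    have h := coeff_recenter_eq_zero (hf P hP) (t := (i, j)) (by simp only; omega)
    rw [eq_sum_monomials hdeg, map_list_sum, ← lcoeff_apply, map_list_sum, List.map_map,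
      List.map_map] at h
    rw [← h]
    congr 1
    refine List.map_congr_left fun s _ => ?_
    simp [coeff_recenter_monomial, condEntry]
  rw [eq_sum_monomials hdeg]
  refine List.sum_eq_zero fun g hg => ?_
  obtain ⟨s, hs, rfl⟩ := List.mem_map.1 hg
  rw [hcoeff s hs, map_zero]

theorem L21_5_6p2_7p7_empty :
    ∃ (p : ℂ × ℂ) (q : Fin 2 → ℂ × ℂ) (r : Fin 7 → ℂ × ℂ),
      ∀ f : MvPolynomial (Fin 2) ℂ, f.totalDegree ≤ 21 →
        f ∈ ptIdeal p ^ 5 → (∀ i, f ∈ ptIdeal (q i) ^ 6) → (∀ i, f ∈ ptIdeal (r i) ^ 7) → f = 0 := by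
  refine ⟨(1, 2), ![(6, 2), (5, 2)],
    ![(5, 1), (6, 8), (3, 7), (7, 3), (6, 5), (7, 6), (8, 7)], fun f hdeg hp hq hr => ?_⟩
  refine eq_zero_of_mem_ptIdeal hdeg ?_
  simp only [Fin.forall_fin_succ] at hq hr
  simp [points] at hp hq hr ⊢
  tauto
end

section
/- There exist points p, q, r_1, …, r_9 ∈ ℂ² such that the only polynomial f ∈ ℂ[x,y] of total degree at most 22 that vanishes to order at least 2 at p, to order at least 6 at q, and to order at least 7 at each r_i is the zero polynomial. (The linear system L_22(2, 6, 7^9) is empty and non-special; note C(24,2) = C(3,2) + C(7,2) + 9·C(8,2) = 276.) -/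
open MvPolynomial

/-! ### Linear conditions imposed by a multiple point -/

theorem Derivation.apply_mem_ideal_pow {R A : Type*} [CommRing R] [CommRing A] [Algebra R A]
    (D : Derivation R A A) (I : Ideal A) (k : ℕ) {f : A} (hf : f ∈ I ^ (k + 1)) :
    D f ∈ I ^ k := by
  induction k generalizing f with
  | zero => simp
  | succ k ih =>
    rw [pow_succ] at hf
    induction hf using Submodule.mul_induction_on' with
    | mem_mul_mem a ha b hb =>
      rw [D.leibniz, smul_eq_mul, smul_eq_mul]
      refine add_mem (Ideal.mul_mem_right _ _ ha) ?_
      rw [mul_comm, pow_succ]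
      exact Ideal.mul_mem_mul (ih ha) hb
    | add a _ b _ ha hb => simpa using add_mem ha hb

theorem aeval_eq_zero_of_mem_ptIdeal {p : ℂ × ℂ} {f : MvPolynomial (Fin 2) ℂ}
    (hf : f ∈ ptIdeal p) : aeval ![p.1, p.2] f = 0 := by
  have hle : ptIdeal p ≤ RingHom.ker (aeval (R := ℂ) ![p.1, p.2]) := by
    refine Ideal.span_le.2 ?_
    rintro g (rfl | rfl) <;> simp
  exact hle hf

/-- The monomial `x ^ a * y ^ b`. -/
noncomputable def mon (x : ℕ × ℕ) : MvPolynomial (Fin 2) ℂ := X 0 ^ x.1 * X 1 ^ x.2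

/-- The first order operator `α x ∂/∂x + β y ∂/∂y + γ`, with `l = (α, β, γ)`. -/
noncomputable def eulerOp (l : ℂ × ℂ × ℂ) :
    MvPolynomial (Fin 2) ℂ →ₗ[ℂ] MvPolynomial (Fin 2) ℂ :=
  ((C l.1 * X 0 : MvPolynomial (Fin 2) ℂ) • pderiv (R := ℂ) (0 : Fin 2) +
    (C l.2.1 * X 1 : MvPolynomial (Fin 2) ℂ) • pderiv (R := ℂ) (1 : Fin 2) :
      Derivation ℂ (MvPolynomial (Fin 2) ℂ) (MvPolynomial (Fin 2) ℂ)).toLinearMap +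
    l.2.2 • LinearMap.id

/-- The value at the exponent `x` of the affine form with coefficients `l`. -/
def affineForm (l : ℂ × ℂ × ℂ) (x : ℕ × ℕ) : ℂ := l.1 * x.1 + l.2.1 * x.2 + l.2.2

theorem X_mul_pderiv_X_pow (i : Fin 2) (a : ℕ) :
    X i * pderiv i (X i ^ a : MvPolynomial (Fin 2) ℂ) = C (a : ℂ) * X i ^ a := by
  rcases a with _ | a
  · simp
  · rw [Derivation.leibniz_pow]
    simp [pow_succ]
    ring

theorem eulerOp_mon (l : ℂ × ℂ × ℂ) (x : ℕ × ℕ) :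
    eulerOp l (mon x) = affineForm l x • mon x := by
  have h0 := X_mul_pderiv_X_pow 0 x.1
  have h1 := X_mul_pderiv_X_pow 1 x.2
  have h01 : pderiv 0 (X 1 ^ x.2 : MvPolynomial (Fin 2) ℂ) = 0 := by
    simp [Derivation.leibniz_pow]
  have h10 : pderiv 1 (X 0 ^ x.1 : MvPolynomial (Fin 2) ℂ) = 0 := by
    simp [Derivation.leibniz_pow]
  simp only [eulerOp, mon, affineForm, LinearMap.add_apply, LinearMap.smul_apply,
    LinearMap.id_apply, Derivation.coeFn_coe, Derivation.add_apply, Derivation.smul_apply,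
    Derivation.leibniz, h01, h10, smul_eq_mul, MvPolynomial.smul_eq_C_mul, map_add, map_mul]
  linear_combination C l.1 * X 1 ^ x.2 * h0 + C l.2.1 * X 0 ^ x.1 * h1

theorem eulerOp_mem (l : ℂ × ℂ × ℂ) (I : Ideal (MvPolynomial (Fin 2) ℂ)) (k : ℕ)
    {f : MvPolynomial (Fin 2) ℂ} (hf : f ∈ I ^ (k + 1)) : eulerOp l f ∈ I ^ k := by
  refine add_mem (Derivation.apply_mem_ideal_pow _ I k hf) ?_
  exact Submodule.smul_of_tower_mem _ l.2.2 (Ideal.pow_le_pow_right k.le_succ hf)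

/-- The polynomial with coefficients `c` on the set of exponents `T`. -/
noncomputable def polyOf (T : Finset (ℕ × ℕ)) : (T → ℂ) →ₗ[ℂ] MvPolynomial (Fin 2) ℂ :=
  Fintype.linearCombination ℂ fun x : T => mon x

theorem polyOf_apply (T : Finset (ℕ × ℕ)) (c : T → ℂ) :
    polyOf T c = ∑ x : T, c x • mon x := rfl

theorem exists_polyOf_eq {T : Finset (ℕ × ℕ)} {f : MvPolynomial (Fin 2) ℂ}
    (hf : ∀ e ∈ f.support, (e 0, e 1) ∈ T) : ∃ c, polyOf T c = f := by
  have hmem : f ∈ Submodule.span ℂ (Set.range fun x : T => mon x) := by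
    rw [f.as_sum]
    refine Submodule.sum_mem _ fun e he => ?_
    rw [monomial_eq, Finsupp.prod_fintype _ _ (by simp), Fin.prod_univ_two, ← smul_eq_C_mul]
    exact Submodule.smul_mem _ _ (Submodule.subset_span ⟨⟨(e 0, e 1), hf e he⟩, rfl⟩)
  exact (Submodule.mem_span_range_iff_exists_fun ℂ).1 hmem

theorem eulerOp_polyOf (l : ℂ × ℂ × ℂ) (T : Finset (ℕ × ℕ)) (c : T → ℂ) :
    eulerOp l (polyOf T c) = polyOf T fun x => c x * affineForm l x := by
  simp only [polyOf_apply, map_sum, map_smul, eulerOp_mon, smul_smul]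

theorem sum_eq_zero_of_polyOf_mem {T : Finset (ℕ × ℕ)} {p : ℂ × ℂ} (L : List (ℂ × ℂ × ℂ)) {m : ℕ}
    (hL : L.length < m) {c : T → ℂ} (hc : polyOf T c ∈ ptIdeal p ^ m) :
    ∑ x : T, c x * (L.map fun l => affineForm l x).prod * (p.1 ^ x.1.1 * p.2 ^ x.1.2) = 0 := by
  induction L generalizing m c with
  | nil =>
    have h := aeval_eq_zero_of_mem_ptIdeal (Ideal.pow_le_self (by simpa using hL.ne') hc)
    simpa [polyOf_apply, mon] using h
  | cons l L ih =>
    obtain ⟨m, rfl⟩ : ∃ k, m = k + 1 := ⟨m - 1, by grind⟩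
    have h := ih (m := m) (by simpa using hL)
      (eulerOp_polyOf l T c ▸ eulerOp_mem l _ m hc)
    simpa [mul_assoc] using h

/-! ### Degenerating a point to the boundary of the torus -/

open Filter Topology in
/-- If `V` contains no nonzero vector vanishing on `D`, and each `s ∈ D` is the index of the
dominant term, as `t → ∞`, of an equation of `U t`, then some `U t` meets `V` trivially. -/
theorem exists_disjoint_of_dominant {ι : Type*} [Fintype ι] (V : Submodule ℂ (ι → ℂ))
    (U : ℕ → Submodule ℂ (ι → ℂ)) (S D : Set ι) (w : ι → ℤ) (P : ι → ι → ℂ)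
    (hVS : ∀ c ∈ V, ∀ x ∉ S, c x = 0)
    (hP : ∀ s ∈ D, P s s ≠ 0)
    (hP0 : ∀ s ∈ D, ∀ x ∈ S, x ≠ s → w s ≤ w x → P s x = 0)
    (hU : ∀ t, ∀ c ∈ U t, ∀ s ∈ D, ∑ x, c x * P s x * ((t : ℂ) + 1) ^ w x = 0)
    (hVD : ∀ c ∈ V, (∀ s ∈ D, c s = 0) → c = 0) :
    ∃ t, ∀ c ∈ V, c ∈ U t → c = 0 := by
  classical
  by_contra! h
  have hunit : ∀ t, ∃ c ∈ V, c ∈ U t ∧ ‖c‖ = 1 := by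
    intro t
    obtain ⟨c, hV, hUt, hc⟩ := h t
    refine ⟨((‖c‖⁻¹ : ℝ) : ℂ) • c, V.smul_mem _ hV, (U t).smul_mem _ hUt, ?_⟩
    rw [norm_smul]
    simp [hc]
  choose c hcV hcU hc using hunit
  obtain ⟨a, ha, φ, hφ, hlim⟩ := (isCompact_sphere (0 : ι → ℂ) 1).tendsto_subseq
    (x := c) (fun t => by simpa using hc t)
  have haV : a ∈ V :=
    V.closed_of_finiteDimensional.mem_of_tendsto hlim (Eventually.of_forall fun t => hcV _)
  have hle : ∀ t x, ‖c t x‖ ≤ 1 := fun t x => (norm_le_pi_norm (c t) x).trans (hc t).le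
  have hbase : ∀ t : ℕ, (t : ℂ) + 1 ≠ 0 := fun t => by exact_mod_cast t.succ_ne_zero
  have haD : ∀ s ∈ D, a s = 0 := by
    intro s hs
    have hterm : ∀ x ∈ Finset.univ.erase s,
        Tendsto (fun t => c t x * P s x * ((t : ℂ) + 1) ^ (w x - w s)) atTop (𝓝 0) := by
      intro x hx
      by_cases hxS : x ∈ S
      · rcases le_or_gt (w s) (w x) with hw | hw
        · simp [hP0 s hs x hxS (Finset.ne_of_mem_erase hx) hw]
        · have hinv : Tendsto (fun t : ℕ => ((t : ℝ) + 1)⁻¹ * ‖P s x‖) atTop (𝓝 0) := by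
            have := tendsto_one_div_add_atTop_nhds_zero_nat (𝕜 := ℝ)
            simpa using this.mul_const ‖P s x‖
          refine squeeze_zero_norm (fun t => ?_) hinv
          have hnorm : ‖(t : ℂ) + 1‖ = (t : ℝ) + 1 := by
            have := Complex.norm_natCast (t + 1)
            push_cast at this
            exact this
          rw [norm_mul, norm_mul, norm_zpow, hnorm, mul_comm, mul_comm ‖c t x‖]
          refine mul_le_mul ?_ (mul_le_of_le_one_right (norm_nonneg _) (hle t x)) (by positivity)
            (by positivity)
          rw [← zpow_neg_one]
          exact zpow_le_zpow_right₀ (by simp) (by lia)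
      · simp [hVS _ (hcV _) x hxS]
    have hsum := tendsto_finsetSum _ hterm
    have heq : ∀ t, ∑ x ∈ Finset.univ.erase s, c t x * P s x * ((t : ℂ) + 1) ^ (w x - w s)
        = -(c t s * P s s) := by
      intro t
      have h0 := hU t (c t) (hcU t) s hs
      rw [← Finset.add_sum_erase _ _ (Finset.mem_univ s)] at h0
      simp_rw [zpow_sub₀ (hbase t), ← mul_div_assoc]
      rw [← Finset.sum_div, div_eq_iff (zpow_ne_zero _ (hbase t))]
      linear_combination h0
    simp_rw [heq, Finset.sum_const_zero] at hsum
    have h1 := hsum.comp hφ.tendsto_atTop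
    have h2 : Tendsto (fun t => -(c (φ t) s * P s s)) atTop (𝓝 (-(a s * P s s))) :=
      (((tendsto_pi_nhds.1 hlim) s).mul_const _).neg
    have h3 := tendsto_nhds_unique h1 h2
    simpa [hP s hs] using h3.symm
  have := hVD a haV haD
  simp [this] at ha

/-! ### Cutting exponents off by parallel lines -/

/-- The value at the exponent `x` of the linear form with coefficients `u`. -/
def linForm (u : ℤ × ℤ) (x : ℕ × ℕ) : ℤ := u.1 * x.1 + u.2 * x.2

/-- A way to cut off a set of exponents by the conditions of a point of multiplicity `mult`:
exponents are ordered lexicographically by `u` and `v`, where `u` is bounded by `top` and `v` is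
bounded by `heights[j]` on the level `u = top - j`. -/
structure Cut where
  mult : ℕ
  u : ℤ × ℤ
  v : ℤ × ℤ
  top : ℤ
  heights : List ℤ

/-- The bound for `v` on the level of `u` through `x`. -/
def Cut.height (K : Cut) (x : ℕ × ℕ) : ℤ := K.heights.getD (K.top - linForm K.u x).toNat 0

/-- The exponent `x` respects the bounds of `K`. -/
def Cut.Bounds (K : Cut) (x : ℕ × ℕ) : Prop :=
  linForm K.u x ≤ K.top ∧ (K.top - linForm K.u x < K.mult → linForm K.v x ≤ K.height x)

/-- Fewer than `K.mult` levels of `u`, or of `v` within the level of `u`, lie above `s`. -/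
def Cut.Removes (K : Cut) (s : ℕ × ℕ) : Prop :=
  K.top - linForm K.u s < K.mult ∧
    K.top - linForm K.u s + (K.height s - linForm K.v s) < K.mult

instance (K : Cut) (x : ℕ × ℕ) : Decidable (K.Bounds x) := inferInstanceAs (Decidable (_ ∧ _))

instance (K : Cut) (s : ℕ × ℕ) : Decidable (K.Removes s) := inferInstanceAs (Decidable (_ ∧ _))

theorem eq_of_linForm_eq {u v : ℤ × ℤ} (h : u.1 * v.2 - u.2 * v.1 ≠ 0) {x y : ℕ × ℕ}
    (hu : linForm u x = linForm u y) (hv : linForm v x = linForm v y) : x = y := by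
  unfold linForm at hu hv
  have h1 : (u.1 * v.2 - u.2 * v.1) * ((x.1 : ℤ) - y.1) = 0 := by
    linear_combination v.2 * hu - u.2 * hv
  have h2 : (u.1 * v.2 - u.2 * v.1) * ((x.2 : ℤ) - y.2) = 0 := by
    linear_combination u.1 * hv - v.1 * hu
  have h1 := (mul_eq_zero.1 h1).resolve_left h
  have h2 := (mul_eq_zero.1 h2).resolve_left h
  ext <;> lia

/-- The forms `u - (u s + 1), …, u - (u s + k)`. -/
def formsAbove (u : ℤ × ℤ) (s : ℕ × ℕ) (k : ℕ) : List (ℂ × ℂ × ℂ) :=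
  (List.range k).map fun i : ℕ => ((u.1 : ℂ), (u.2 : ℂ), -((linForm u s + i + 1 : ℤ) : ℂ))

theorem prod_formsAbove_eq_zero_iff (u : ℤ × ℤ) (s x : ℕ × ℕ) (k : ℕ) :
    ((formsAbove u s k).map fun l => affineForm l x).prod = 0 ↔
      linForm u s < linForm u x ∧ linForm u x ≤ linForm u s + k := by
  have hform : ∀ i : ℕ, affineForm ((u.1 : ℂ), (u.2 : ℂ), -((linForm u s + i + 1 : ℤ) : ℂ)) x =
      ((linForm u x - (linForm u s + i + 1) : ℤ) : ℂ) := by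
    intro i
    simp only [affineForm, linForm]
    push_cast
    ring
  simp only [formsAbove, List.map_map, List.prod_eq_zero_iff, List.mem_map, List.mem_range,
    Function.comp_apply, hform, Int.cast_eq_zero]
  constructor
  · rintro ⟨i, hi, h⟩
    lia
  · rintro ⟨h1, h2⟩
    exact ⟨(linForm u x - linForm u s - 1).toNat, by lia, by lia⟩

/-- The coefficient vectors on `T`, supported where `S` holds, of the polynomials vanishing at
the points `z i` to order `m i` for all `i ∈ J`. -/
noncomputable def system (T : Finset (ℕ × ℕ)) (S : ℕ × ℕ → Prop) (J : Set ℕ) (m : ℕ → ℕ)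
    (z : ℕ → ℂ × ℂ) : Submodule ℂ (T → ℂ) where
  carrier := {c | (∀ x : T, ¬ S x → c x = 0) ∧ ∀ i ∈ J, polyOf T c ∈ ptIdeal (z i) ^ m i}
  zero_mem' := by simp
  add_mem' := by
    rintro a b ⟨ha, ha'⟩ ⟨hb, hb'⟩
    refine ⟨fun x hx => by simp [ha x hx, hb x hx], fun i hi => ?_⟩
    rw [map_add]
    exact add_mem (ha' i hi) (hb' i hi)
  smul_mem' := by
    rintro r a ⟨ha, ha'⟩
    refine ⟨fun x hx => by simp [ha x hx], fun i hi => ?_⟩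
    rw [map_smul]
    exact Submodule.smul_of_tower_mem _ r (ha' i hi)

theorem exists_weight (K : Cut) (T : Finset (ℕ × ℕ)) : ∃ N : ℤ, ∀ s ∈ T, ∀ x ∈ T,
    N * linForm K.u s + linForm K.v s ≤ N * linForm K.u x + linForm K.v x →
      linForm K.u s < linForm K.u x ∨
        linForm K.u s = linForm K.u x ∧ linForm K.v s ≤ linForm K.v x := by
  obtain ⟨N, hN⟩ := ((T ×ˢ T).image fun y => linForm K.v y.2 - linForm K.v y.1).bddAbove
  refine ⟨max N 0 + 1, fun s hs x hx h => ?_⟩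
  have hb : linForm K.v x - linForm K.v s ≤ N := hN (by
    rw [Finset.mem_coe, Finset.mem_image]
    exact ⟨(s, x), Finset.mem_product.2 ⟨hs, hx⟩, rfl⟩)
  rcases lt_trichotomy (linForm K.u s) (linForm K.u x) with hu | hu | hu
  · exact Or.inl hu
  · rw [hu] at h
    exact Or.inr ⟨hu, by linarith⟩
  · exfalso
    have : 0 ≤ (max N 0 + 1) * (linForm K.u s - linForm K.u x - 1) :=
      mul_nonneg (by positivity) (by lia)
    have := le_max_left N 0
    nlinarith

theorem exists_point_of_cut (K : Cut) (hK : K.u.1 * K.v.2 - K.u.2 * K.v.1 ≠ 0)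
    (T : Finset (ℕ × ℕ)) (S S' : ℕ × ℕ → Prop)
    (hS : ∀ x ∈ T, S x → K.Bounds x) (hS' : ∀ s ∈ T, S s → ¬ S' s → K.Removes s) (V : Submodule ℂ (T → ℂ))
    (hV : ∀ c ∈ V, ∀ x : T, ¬ S x → c x = 0)
    (hV' : ∀ c ∈ V, (∀ x : T, ¬ S' x → c x = 0) → c = 0) :
    ∃ p : ℂ × ℂ, ∀ c ∈ V, polyOf T c ∈ ptIdeal p ^ K.mult → c = 0 := by
  obtain ⟨N, hN⟩ := exists_weight K T
  let pt : ℕ → ℂ × ℂ := fun t =>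
    (((t : ℂ) + 1) ^ (N * K.u.1 + K.v.1), ((t : ℂ) + 1) ^ (N * K.u.2 + K.v.2))
  let jump : ℕ × ℕ → ℕ := fun s => (K.top - linForm K.u s).toNat
  let forms : ℕ × ℕ → List (ℂ × ℂ × ℂ) := fun s =>
    formsAbove K.u s (jump s) ++ formsAbove K.v s (K.mult - 1 - jump s)
  have hbase : ∀ t : ℕ, (t : ℂ) + 1 ≠ 0 := fun t => by exact_mod_cast t.succ_ne_zero
  have hpt : ∀ (t : ℕ) (x : ℕ × ℕ), (pt t).1 ^ x.1 * (pt t).2 ^ x.2 =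
      ((t : ℂ) + 1) ^ (N * linForm K.u x + linForm K.v x) := by
    intro t x
    simp only [pt, ← zpow_natCast, ← zpow_mul]
    rw [← zpow_add₀ (hbase t)]
    congr 1
    simp only [linForm]
    ring
  suffices h : ∃ t, ∀ c ∈ V, polyOf T c ∈ ptIdeal (pt t) ^ K.mult → c = 0 by
    obtain ⟨t, ht⟩ := h
    exact ⟨pt t, ht⟩
  refine exists_disjoint_of_dominant V
    (fun t => ((ptIdeal (pt t) ^ K.mult).restrictScalars ℂ).comap (polyOf T))
    {x : T | S x} {x : T | S x ∧ ¬ S' x}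
    (fun x => N * linForm K.u x + linForm K.v x)
    (fun s x => ((forms s).map fun l => affineForm l x).prod) hV ?_ ?_ ?_ ?_
  · intro s _
    simp only [forms, List.map_append, List.prod_append, ne_eq, mul_eq_zero,
      prod_formsAbove_eq_zero_iff]
    lia
  · rintro s ⟨hs, hs'⟩ x hx hxs hw
    obtain ⟨hle, hlt⟩ := hS x x.2 hx
    obtain ⟨hs1, hs2⟩ := hS' s s.2 hs hs'
    simp only [forms, List.map_append, List.prod_append, mul_eq_zero,
      prod_formsAbove_eq_zero_iff]
    rcases hN s s.2 x x.2 hw with hu | ⟨hu, hv⟩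
    · left
      lia
    · right
      have hne : linForm K.v s ≠ linForm K.v x := fun hv =>
        hxs (Subtype.ext (eq_of_linForm_eq hK hu hv).symm)
      rw [Cut.height, ← hu] at hlt
      have := hlt hs1
      rw [Cut.height] at hs2
      lia
  · rintro t c hc s ⟨hs, hs'⟩
    have hs0 := (hS s s.2 hs).1
    have hs1 := (hS' s s.2 hs hs').1
    have hlen : (forms s).length < K.mult := by
      simp only [forms, formsAbove, List.length_append, List.length_map, List.length_range]
      lia
    have := sum_eq_zero_of_polyOf_mem (forms s) hlen hc
    simpa only [hpt] using this
  · intro c hc h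
    refine hV' c hc fun x hx => ?_
    by_cases hS : S x
    · exact h x ⟨hS, hx⟩
    · exact hV c hc x hS

/-- If the exponents in `T` are cut off successively, those labelled `i` by the cut `K i`, then
points of multiplicities `(K i).mult` can be chosen so that no nonzero polynomial with exponents
in `T` has these multiplicities. -/
theorem exists_points_of_cuts (T : Finset (ℕ × ℕ)) (label : ℕ × ℕ → ℕ) (n : ℕ) (K : ℕ → Cut)
    (hlabel : ∀ x ∈ T, label x < n)
    (hK : ∀ i < n, (K i).u.1 * (K i).v.2 - (K i).u.2 * (K i).v.1 ≠ 0)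
    (hbounds : ∀ i < n, ∀ x ∈ T, i ≤ label x → (K i).Bounds x)
    (hrem : ∀ s ∈ T, (K (label s)).Removes s) :
    ∃ z : ℕ → ℂ × ℂ, ∀ c : T → ℂ,
      (∀ i < n, polyOf T c ∈ ptIdeal (z i) ^ (K i).mult) → c = 0 := by
  have key : ∀ k ≤ n, ∃ z : ℕ → ℂ × ℂ, ∀ c ∈ system T (fun x => k ≤ label x) (Set.Ico k n)
      (fun i => (K i).mult) z, c = 0 := by
    intro k hk
    induction hk using Nat.decreasingInduction with
    | self => exact ⟨0, fun c hc => funext fun x => hc.1 x (by simpa using hlabel x x.2)⟩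
    | of_succ k hk ih =>
      obtain ⟨z, hz⟩ := ih
      obtain ⟨p, hp⟩ := exists_point_of_cut (K k) (hK k hk) T (fun x => k ≤ label x)
        (fun x => k + 1 ≤ label x) (hbounds k hk)
        (fun s hs h1 h2 => by
          obtain rfl : k = label s := by lia
          exact hrem s hs)
        (system T (fun x => k ≤ label x) (Set.Ico (k + 1) n) (fun i => (K i).mult) z)
        (fun c hc => hc.1) (fun c hc h => hz c ⟨h, hc.2⟩)
      refine ⟨Function.update z k p, fun c hc => hp c ⟨hc.1, fun i hi => ?_⟩ ?_⟩
      · have hik : i ≠ k := by grind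
        simpa [hik] using hc.2 i ⟨by grind, hi.2⟩
      · simpa using hc.2 k ⟨le_rfl, hk⟩
  obtain ⟨z, hz⟩ := key 0 n.zero_le
  exact ⟨z, fun c hc => hz c ⟨by simp, fun i hi => hc i hi.2⟩⟩

/-! ### Degree 22 -/

/-- The exponents of the monomials of degree at most 22. -/
def triangle : Finset (ℕ × ℕ) :=
  {x ∈ Finset.range 23 ×ˢ Finset.range 23 | x.1 + x.2 ≤ 22}

theorem mem_triangle {x : ℕ × ℕ} : x ∈ triangle ↔ x.1 + x.2 ≤ 22 := by
  rw [triangle, Finset.mem_filter, Finset.mem_product, Finset.mem_range, Finset.mem_range]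
  lia

/-- Row `a`, column `b` holds the index of the cut that removes the exponent `(a, b)`. -/
def labelTable : List (List ℕ) :=
  [[4, 4, 4, 4, 4, 4, 4, 5, 5, 5, 5, 5, 5, 5, 6, 6, 0, 0, 0, 0, 0, 0, 0],
   [4, 4, 4, 4, 4, 4, 5, 5, 5, 5, 5, 5, 6, 6, 6, 1, 0, 0, 0, 0, 0, 0],
   [4, 4, 4, 4, 4, 5, 5, 5, 5, 5, 10, 6, 6, 6, 6, 1, 0, 0, 0, 0, 0],
   [4, 4, 4, 4, 5, 5, 5, 5, 10, 10, 9, 6, 6, 6, 1, 1, 0, 0, 0, 0],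
   [4, 4, 4, 5, 5, 5, 10, 10, 9, 9, 7, 6, 6, 6, 1, 1, 0, 0, 0],
   [4, 4, 5, 5, 10, 10, 10, 9, 9, 9, 7, 6, 6, 1, 1, 1, 0, 0],
   [4, 5, 10, 10, 10, 10, 9, 9, 9, 9, 6, 6, 6, 1, 1, 1, 0],
   [10, 10, 10, 10, 10, 9, 9, 9, 9, 9, 6, 6, 1, 1, 1, 1],
   [10, 10, 10, 10, 9, 9, 9, 9, 9, 9, 6, 6, 1, 1, 1],
   [3, 8, 8, 9, 9, 9, 9, 9, 9, 9, 6, 1, 1, 1],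
   [3, 3, 8, 8, 8, 8, 8, 8, 8, 7, 6, 1, 1],
   [3, 3, 3, 8, 8, 8, 8, 8, 8, 6, 1, 1],
   [3, 3, 3, 3, 8, 8, 8, 8, 8, 6, 1],
   [3, 3, 3, 3, 3, 8, 8, 8, 8, 1],
   [3, 3, 3, 3, 3, 3, 8, 8, 8],
   [3, 3, 3, 3, 3, 3, 3, 8],
   [2, 2, 2, 2, 2, 2, 2],
   [2, 2, 2, 2, 2, 2],
   [2, 2, 2, 2, 2],
   [2, 2, 2, 2],
   [2, 2, 2],
   [2, 2],
   [2]]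

def label (x : ℕ × ℕ) : ℕ := (labelTable.getD x.1 []).getD x.2 0

def cutTable : List Cut :=
  [⟨7, (1, 1), (-1, 0), 22, [0, 0, 0, 0, 0, 0, 0]⟩,
   ⟨7, (0, 1), (1, 0), 15, [7, 8, 9, 10, 11, 12, 13]⟩,
   ⟨7, (0, -1), (1, 0), 0, [22, 21, 20, 19, 18, 17, 16]⟩,
   ⟨7, (1, 0), (0, -1), 15, [0, 0, 0, 0, 0, 0, 0]⟩,
   ⟨7, (-1, 0), (0, -1), 0, [0, 0, 0, 0, 0, 0, 0]⟩,
   ⟨7, (-1, -1), (-1, 0), -7, [0, 0, 0, 0, 0, 0, 0]⟩,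
   ⟨7, (1, 2), (0, 1), 30, [15, 14, 14, 13, 12, 12, 11]⟩,
   ⟨2, (0, 1), (1, 0), 10, [5, 10]⟩,
   ⟨7, (1, -1), (1, 0), 8, [15, 14, 14, 13, 12, 11, 10]⟩,
   ⟨7, (1, 0), (0, 1), 9, [9, 9, 9, 9, 9, 9, 10]⟩,
   ⟨6, (-2, -1), (1, 0), -14, [7, 7, 8, 8, 8, 8]⟩]

def cutAt (i : ℕ) : Cut := cutTable.getD i ⟨0, 0, 0, 0, []⟩

theorem cutAt_bounds :
    ∀ i < 11, ∀ x ∈ triangle, i ≤ label x → (cutAt i).Bounds x := by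
  decide +kernel

theorem cutAt_removes : ∀ s ∈ triangle, (cutAt (label s)).Removes s := by
  decide +kernel

theorem L22_2_6_7p9_empty :
    ∃ (p : ℂ × ℂ) (q : ℂ × ℂ) (r : Fin 9 → ℂ × ℂ),
      ∀ f : MvPolynomial (Fin 2) ℂ, f.totalDegree ≤ 22 →
        f ∈ ptIdeal p ^ 2 → f ∈ ptIdeal q ^ 6 → (∀ i, f ∈ ptIdeal (r i) ^ 7) → f = 0 := by
  obtain ⟨z, hz⟩ := exists_points_of_cuts triangle label 11 cutAt (by decide +kernel)
    (by decide) cutAt_bounds cutAt_removes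
  refine ⟨z 7, z 10, fun i => z (![0, 1, 2, 3, 4, 5, 6, 8, 9] i), fun f hf hp hq hr => ?_⟩
  obtain ⟨c, rfl⟩ := exists_polyOf_eq (T := triangle) fun e he => by
    have := (le_totalDegree he).trans hf
    rw [Finsupp.sum_fintype _ _ (by simp), Fin.sum_univ_two] at this
    exact mem_triangle.2 this
  rw [hz c fun i hi => ?_, map_zero]
  interval_cases i
  exacts [hr 0, hr 1, hr 2, hr 3, hr 4, hr 5, hr 6, hp, hr 7, hr 8, hq]
end

section
/- There exist points p, q_1, …, q_13 ∈ ℂ² such that the only polynomial f ∈ ℂ[x,y] of total degree at most 22 that vanishes to order at least 2 at p and to order at least 6 at each q_i is the zero polynomial. (Lemma le:save: the linear system L_22(2, 6^13) is empty and non-special; note C(24,2) = C(3,2) + 13·C(7,2) = 276.) -/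
open MvPolynomial

/-- Bitwise exclusive or commutes with concatenation of base `2 ^ R` digits. -/
lemma xor_add_two_pow_mul {R a b : ℕ} (ha : a < 2 ^ R) (hb : b < 2 ^ R) (x y : ℕ) :
    (a + 2 ^ R * x) ^^^ (b + 2 ^ R * y) = (a ^^^ b) + 2 ^ R * (x ^^^ y) := by
  refine Nat.eq_of_testBit_eq fun k => ?_
  have hab := Nat.xor_lt_two_pow ha hb
  rw [add_comm a, add_comm b, add_comm (a ^^^ b), Nat.testBit_xor,
    Nat.testBit_two_pow_mul_add _ ha, Nat.testBit_two_pow_mul_add _ hb,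
    Nat.testBit_two_pow_mul_add _ hab]
  split_ifs <;> simp

lemma and_add_two_pow_mul {R a b : ℕ} (ha : a < 2 ^ R) (hb : b < 2 ^ R) (x y : ℕ) :
    (a + 2 ^ R * x) &&& (b + 2 ^ R * y) = (a &&& b) + 2 ^ R * (x &&& y) := by
  refine Nat.eq_of_testBit_eq fun k => ?_
  have hab := Nat.and_lt_two_pow a hb
  rw [add_comm a, add_comm b, add_comm (a &&& b), Nat.testBit_and,
    Nat.testBit_two_pow_mul_add _ ha, Nat.testBit_two_pow_mul_add _ hb,
    Nat.testBit_two_pow_mul_add _ hab]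
  split_ifs <;> simp

/-- Add `v` over `𝔽₂` to the vectors whose `k`-th bit is set; this clears that bit when it is set
in `v`. -/
def clearBit (k v w : ℕ) : ℕ := w ^^^ (w.testBit k).toNat * v

/-- Gaussian elimination over `𝔽₂` on the `n` bit vectors that are the base `B` digits of `A`.
All digits are updated at once: `u` has its first `n` digits equal to `1`, so that masking by
`2 ^ k * u` selects the `k`-th bit of each digit. -/
def bitsIndependent (B : ℕ) : ℕ → ℕ → ℕ → Bool
  | 0, _, _ => true
  | n + 1, u, A =>
    !(Nat.beq (A % B) 0) && bitsIndependent B n (u / B)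
      (A / B ^^^ ((A / B &&& 2 ^ (A % B).log2 * (u / B)) / 2 ^ (A % B).log2 * (A % B)))

lemma ofDigits_clearBit {R k v : ℕ} (hk : k < R) (hv : v < 2 ^ R) (l : List ℕ)
    (hl : ∀ w ∈ l, w < 2 ^ R) :
    Nat.ofDigits (2 ^ R) l ^^^
      ((Nat.ofDigits (2 ^ R) l &&& 2 ^ k * Nat.ofDigits (2 ^ R) (l.map fun _ => 1)) / 2 ^ k * v) =
      Nat.ofDigits (2 ^ R) (l.map (clearBit k v)) := by
  have hmask : ∀ l : List ℕ, (∀ w ∈ l, w < 2 ^ R) →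
      (Nat.ofDigits (2 ^ R) l &&& 2 ^ k * Nat.ofDigits (2 ^ R) (l.map fun _ => 1)) / 2 ^ k =
        Nat.ofDigits (2 ^ R) (l.map fun w => (w.testBit k).toNat) := by
    intro l hl
    refine Nat.div_eq_of_eq_mul_right (by positivity) ?_
    induction l with
    | nil => simp
    | cons w l ih =>
      simp only [List.map_cons, Nat.ofDigits_cons, mul_add, mul_one,
        mul_left_comm (2 ^ k) (2 ^ R)]
      rw [and_add_two_pow_mul (hl w (by simp)) (Nat.pow_lt_pow_right one_lt_two hk),
        ih fun x hx => hl x (by simp [hx]), Nat.and_two_pow]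
      ring
  rw [hmask l hl]
  induction l with
  | nil => simp
  | cons w l ih =>
    simp only [List.map_cons, Nat.ofDigits_cons, add_mul, mul_assoc]
    rw [xor_add_two_pow_mul (hl w (by simp)), ih fun x hx => hl x (by simp [hx])]
    · rfl
    · cases w.testBit k <;> simp [hv]

/-- If the elimination succeeds then the only relation over `𝔽₂` between the bit vectors, with
coefficients in any elementary abelian `2`-group, is the trivial one. -/
lemma eq_zero_of_bitsIndependent {W : Type*} [AddCommGroup W] {R : ℕ} (n : ℕ) :
    ∀ L : List (ℕ × W), L.length = n → (∀ x ∈ L, x.1 < 2 ^ R) → (∀ x ∈ L, x.2 + x.2 = 0) →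
      bitsIndependent (2 ^ R) n (Nat.ofDigits (2 ^ R) (L.map fun _ => 1))
        (Nat.ofDigits (2 ^ R) (L.map Prod.fst)) = true →
      (∀ k < R, (L.map fun x => if x.1.testBit k then x.2 else 0).sum = 0) →
      ∀ x ∈ L, x.2 = 0 := by
  induction n with
  | zero =>
    intro L hL
    simp [List.eq_nil_of_length_eq_zero hL]
  | succ n ih =>
    rintro (_ | ⟨⟨v, d⟩, L⟩) hlen hlt htwo hind hrel
    · simp
    simp only [List.length_cons, Nat.add_right_cancel_iff] at hlen
    simp only [List.mem_cons, forall_eq_or_imp] at hlt htwo ⊢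
    obtain ⟨hv, hlt⟩ := hlt
    obtain ⟨hd, htwo⟩ := htwo
    have hdiv (a x : ℕ) (ha : a < 2 ^ R) : (a + 2 ^ R * x) / 2 ^ R = x := by
      rw [Nat.add_mul_div_left _ _ (by positivity), Nat.div_eq_of_lt ha, zero_add]
    simp only [List.map_cons, Nat.ofDigits_cons, bitsIndependent, hdiv _ _ hv,
      Nat.add_mul_mod_self_left, Nat.mod_eq_of_lt hv, Bool.and_eq_true] at hind
    obtain ⟨hv0, hind⟩ := hind
    replace hv0 : v ≠ 0 := by
      rintro rfl
      exact absurd hv0 (by decide)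
    have hkR : v.log2 < R := (Nat.log2_lt hv0).2 hv
    rw [hdiv _ _ (Nat.one_lt_two_pow (by omega))] at hind
    simp only [List.map_cons, List.sum_cons] at hrel
    set k := v.log2 with hk
    have hvk : v.testBit k = true := Nat.testBit_log2 hv0
    have hpivot := hrel k hkR
    rw [hvk, if_pos rfl] at hpivot
    have hzero := ih (L.map fun x => (clearBit k v x.1, x.2)) (by simpa using hlen) ?_ ?_ ?_ ?_
    · have hL : ∀ x ∈ L, x.2 = 0 := fun x hx =>
        hzero (clearBit k v x.1, x.2) (List.mem_map.2 ⟨x, hx, rfl⟩)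
      refine ⟨?_, hL⟩
      rwa [List.sum_eq_zero, add_zero] at hpivot
      simp only [List.mem_map]
      rintro _ ⟨x, hx, rfl⟩
      simp [hL x hx]
    · simp only [List.mem_map]
      rintro _ ⟨x, hx, rfl⟩
      refine Nat.xor_lt_two_pow (hlt x hx) ?_
      cases x.1.testBit k <;> simp [hv]
    · simp only [List.mem_map]
      rintro _ ⟨x, hx, rfl⟩
      exact htwo x hx
    · rw [← hind]
      have h := ofDigits_clearBit hkR hv (L.map Prod.fst) (by
        simp only [List.mem_map]
        rintro _ ⟨x, hx, rfl⟩
        exact hlt x hx)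
      simp only [List.map_map, Function.comp_def] at h ⊢
      rw [← h]
    · intro j hj
      have hsum : ∀ M : List (ℕ × W), (∀ x ∈ M, x.2 + x.2 = 0) →
          ((M.map fun x => (clearBit k v x.1, x.2)).map
            fun x => if x.1.testBit j then x.2 else 0).sum =
          (M.map fun x => if x.1.testBit j then x.2 else 0).sum +
            if v.testBit j then (M.map fun x => if x.1.testBit k then x.2 else 0).sum else 0 := by
        intro M hM
        induction M with
        | nil => simp
        | cons x M ihM =>
          have hx : x.2 + x.2 = 0 := hM x (by simp)
          have hterm : (if (clearBit k v x.1).testBit j then x.2 else 0) =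
              (if x.1.testBit j then x.2 else 0) +
                if v.testBit j then (if x.1.testBit k then x.2 else 0) else 0 := by
            rw [clearBit, Nat.testBit_xor]
            cases x.1.testBit k <;> cases hvj : v.testBit j <;> cases x.1.testBit j <;>
              simp [hvj, hx]
          simp only [List.map_cons, List.sum_cons]
          rw [ihM fun y hy => hM y (by simp [hy]), hterm]
          cases v.testBit j
          · simp
          · simp only [if_true]
            abel
      rw [hsum L htwo]
      have hj' := hrel j hj
      have hneg : -d = d := by rw [neg_eq_iff_add_eq_zero, hd]
      cases hvj : v.testBit j with
      | false => simpa [hvj] using hj'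
      | true =>
        rw [hvj, if_pos rfl] at hj'
        rw [if_pos rfl, ← neg_eq_of_add_eq_zero_right hj', ← neg_eq_of_add_eq_zero_right hpivot,
          hneg, hd]

/-- Complex numbers satisfying integral linear relations vanish if the reductions of these
relations modulo `2` are independent. -/
lemma eq_zero_of_parity {ι : Type*} {R : ℕ} (l : List ι) (code : ι → ℕ) (N : ι → ℕ → ℤ)
    (c : ι → ℂ) (hcode : ∀ i ∈ l, code i < 2 ^ R)
    (hN : ∀ i ∈ l, ∀ k < R, (N i k : ZMod 2) = if (code i).testBit k then 1 else 0)
    (hind : bitsIndependent (2 ^ R) l.length (Nat.ofDigits (2 ^ R) (l.map fun _ => 1))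
      (Nat.ofDigits (2 ^ R) (l.map code)) = true)
    (hrel : ∀ k < R, (l.map fun i => (N i k : ℂ) * c i).sum = 0) :
    ∀ i ∈ l, c i = 0 := by
  set G : Submodule ℤ ℂ := Submodule.span ℤ (c '' {i | i ∈ l}) with hG
  have hmem : ∀ i ∈ l, c i ∈ G := fun i hi => Submodule.subset_span ⟨i, hi, rfl⟩
  set H : Submodule ℤ ℂ := Ideal.span {(2 : ℤ)} • G with hH
  have hdouble : ∀ z ∈ G, (2 : ℤ) • z ∈ H := fun z hz =>
    Submodule.smul_mem_smul (Ideal.mem_span_singleton_self 2) hz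
  have hmk : ∀ i ∈ l, H.mkQ (c i) + H.mkQ (c i) = 0 := by
    intro i hi
    rw [← map_add, ← two_zsmul]
    exact (Submodule.Quotient.mk_eq_zero H).2 (hdouble _ (hmem i hi))
  have hzero : ∀ i ∈ l, H.mkQ (c i) = 0 := by
    have := eq_zero_of_bitsIndependent (R := R) l.length (l.map fun i => (code i, H.mkQ (c i)))
      (by simp) (by simpa using hcode) (by simpa using hmk)
      (by simpa only [List.map_map, Function.comp_def] using hind) ?_
    · intro i hi
      exact this _ (List.mem_map_of_mem hi)
    · intro k hk
      have h := congrArg H.mkQ (hrel k hk)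
      rw [map_zero, map_list_sum, List.map_map] at h
      refine Eq.trans ?_ h
      rw [List.map_map]
      refine congrArg List.sum (List.map_congr_left fun i hi => ?_)
      simp only [Function.comp_apply]
      rw [← zsmul_eq_mul, map_zsmul]
      have hNk := hN i hi k hk
      rcases Int.even_or_odd' (N i k) with ⟨m, hm | hm⟩
      · have : (code i).testBit k = false := by
          by_contra h
          rw [hm, if_pos (by simpa using h)] at hNk
          exact absurd hNk (by push_cast; rw [show (2 : ZMod 2) = 0 from rfl]; simp)
        rw [this, hm, mul_comm, mul_zsmul, two_zsmul, hmk i hi]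
        simp
      · have : (code i).testBit k = true := by
          by_contra h
          rw [hm, if_neg h] at hNk
          exact absurd hNk (by push_cast; rw [show (2 : ZMod 2) = 0 from rfl]; simp)
        rw [this, hm, add_zsmul, mul_comm, mul_zsmul, two_zsmul, hmk i hi]
        simp
  have hle : G ≤ Ideal.span {(2 : ℤ)} • G := by
    rw [hG, Submodule.span_le]
    rintro _ ⟨i, hi, rfl⟩
    exact (Submodule.Quotient.mk_eq_zero H).1 (hzero i hi)
  obtain ⟨r, hr, hrG⟩ := Submodule.exists_sub_one_mem_and_smul_eq_zero_of_fg_of_le_smul _ G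
    (Submodule.fg_span ((List.finite_toSet l).image c)) hle
  intro i hi
  have hr0 : r ≠ 0 := by
    rintro rfl
    rw [Ideal.mem_span_singleton] at hr
    omega
  exact (smul_eq_zero.1 (hrG _ (hmem i hi))).resolve_left hr0

/-- The bits of `n` are the parities of the coefficients of `P`. -/
def BitsOf (n : ℕ) (P : Polynomial ℤ) : Prop :=
  ∀ k, ((P.coeff k : ℤ) : ZMod 2) = if n.testBit k then 1 else 0

lemma BitsOf.one : BitsOf 1 1 := by
  intro k
  rcases k with _ | k
  · simp
  · simp [Polynomial.coeff_one, Nat.testBit_succ]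

lemma BitsOf.shiftLeft {n : ℕ} {P : Polynomial ℤ} (h : BitsOf n P) (s : ℕ) :
    BitsOf (n <<< s) (Polynomial.X ^ s * P) := by
  intro k
  rw [Polynomial.coeff_X_pow_mul', Nat.testBit_shiftLeft]
  by_cases hk : s ≤ k
  · simpa [hk] using h (k - s)
  · simp [hk]

lemma BitsOf.add {n m : ℕ} {P Q : Polynomial ℤ} (hP : BitsOf n P) (hQ : BitsOf m Q) :
    BitsOf (n ^^^ m) (P + Q) := by
  intro k
  rw [Polynomial.coeff_add, Int.cast_add, hP k, hQ k, Nat.testBit_xor]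
  cases n.testBit k <;> cases m.testBit k <;> decide

lemma BitsOf.sub {n m : ℕ} {P Q : Polynomial ℤ} (hP : BitsOf n P) (hQ : BitsOf m Q) :
    BitsOf (n ^^^ m) (P - Q) := by
  intro k
  rw [Polynomial.coeff_sub, Int.cast_sub, hP k, hQ k, Nat.testBit_xor]
  cases n.testBit k <;> cases m.testBit k <;> decide

/-- The exponents `(a, b)` of the monomials `x ^ a * y ^ b` of degree between `2` and `22`. -/
def monomialExponents : List (ℕ × ℕ) :=
  (List.range 23 ×ˢ List.range 23).filter fun s => decide (2 ≤ s.1 + s.2) && decide (s.1 + s.2 ≤ 22)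

/-- The pairs `(j, i)` such that `X ^ i` may occur in the quotient by `(X ^ 13 - 1) ^ (6 - j)` of a
polynomial of degree at most `88 - 4 * j`. -/
def quotientExponents : List (ℕ × ℕ) :=
  (List.range 6 ×ˢ List.range 56).filter fun s => decide (s.2 < 11 + 9 * s.1)

/-- The image of `x ^ a * y ^ b` under `x ↦ X`, `y ↦ X ^ 128 + X ^ 4 + X ^ 2 + 1`. -/
noncomputable def monomialImage (s : ℕ × ℕ) : Polynomial ℤ :=
  Polynomial.X ^ s.1 *
    (Polynomial.X ^ 128 + (Polynomial.X ^ 4 + (Polynomial.X ^ 2 + 1))) ^ s.2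

/-- The polynomial `X ^ (128 * j + i) * (X ^ 13 - 1) ^ (6 - j)` attached to `(j, i)`. -/
noncomputable def quotientImage (s : ℕ × ℕ) : Polynomial ℤ :=
  Polynomial.X ^ (128 * s.1 + s.2) * (Polynomial.X ^ 13 - 1) ^ (6 - s.1)

/-- The parities of the first `768` coefficients of `monomialImage s`. -/
def monomialCode (s : ℕ × ℕ) : ℕ :=
  ((fun n => n <<< 128 ^^^ (n <<< 4 ^^^ (n <<< 2 ^^^ n)))^[s.2] 1) <<< s.1 % 2 ^ 768

/-- The parities of the first `768` coefficients of `quotientImage s`. -/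
def quotientCode (s : ℕ × ℕ) : ℕ :=
  ((fun n => n <<< 13 ^^^ n)^[6 - s.1] 1) <<< (128 * s.1 + s.2) % 2 ^ 768

lemma BitsOf.iterate {step : ℕ → ℕ} {P : Polynomial ℤ}
    (h : ∀ n Q, BitsOf n Q → BitsOf (step n) (P * Q)) (b : ℕ) : BitsOf (step^[b] 1) (P ^ b) := by
  induction b with
  | zero => simpa using BitsOf.one
  | succ b ih =>
    rw [Function.iterate_succ_apply', pow_succ']
    exact h _ _ ih

lemma coeff_monomialImage (s : ℕ × ℕ) {k : ℕ} (hk : k < 768) :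
    (((monomialImage s).coeff k : ℤ) : ZMod 2) = if (monomialCode s).testBit k then 1 else 0 := by
  rw [monomialCode, Nat.testBit_mod_two_pow, decide_eq_true hk, Bool.true_and]
  refine (BitsOf.iterate (fun n Q h => ?_) s.2).shiftLeft s.1 k
  simpa only [add_mul, one_mul] using
    (h.shiftLeft 128).add ((h.shiftLeft 4).add ((h.shiftLeft 2).add h))

lemma coeff_quotientImage (s : ℕ × ℕ) {k : ℕ} (hk : k < 768) :
    (((quotientImage s).coeff k : ℤ) : ZMod 2) = if (quotientCode s).testBit k then 1 else 0 := by
  rw [quotientCode, Nat.testBit_mod_two_pow, decide_eq_true hk, Bool.true_and]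
  refine (BitsOf.iterate (fun n Q h => ?_) (6 - s.1)).shiftLeft (128 * s.1 + s.2) k
  simpa only [sub_mul, one_mul] using (h.shiftLeft 13).sub h

/-- The indices of the two families of polynomials. -/
def relationIndices : List ((ℕ × ℕ) ⊕ (ℕ × ℕ)) :=
  quotientExponents.map Sum.inl ++ monomialExponents.map Sum.inr

set_option maxRecDepth 100000 in
lemma bitsIndependent_codes :
    bitsIndependent (2 ^ 768) relationIndices.length
      (Nat.ofDigits (2 ^ 768) (relationIndices.map fun _ => 1))
      (Nat.ofDigits (2 ^ 768) (relationIndices.map (Sum.elim quotientCode monomialCode))) =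
        true := by
  decide +kernel

/-- Polynomials `∑ c_{ab} X ^ a (X ^ 128 + X ^ 4 + X ^ 2 + 1) ^ b` and
`∑ d_{ji} X ^ (128 j + i) (X ^ 13 - 1) ^ (6 - j)` that agree modulo `X ^ 768` are trivial. -/
lemma eq_zero_of_coeff_eq (c d : ℕ × ℕ → ℂ)
    (h : ∀ k < 768,
      (monomialExponents.map fun s => ((monomialImage s).coeff k : ℂ) * c s).sum =
        (quotientExponents.map fun s => ((quotientImage s).coeff k : ℂ) * d s).sum) :
    ∀ s ∈ monomialExponents, c s = 0 := by
  have key := eq_zero_of_parity (R := 768) relationIndices (Sum.elim quotientCode monomialCode)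
    (fun i k => (Sum.elim quotientImage monomialImage i).coeff k) (Sum.elim (fun s => -d s) c)
    ?_ ?_ bitsIndependent_codes ?_
  · intro s hs
    exact key (Sum.inr s) (List.mem_append_right _ (List.mem_map_of_mem hs))
  · rintro (s | s) -
    · exact Nat.mod_lt _ (by positivity)
    · exact Nat.mod_lt _ (by positivity)
  · rintro (s | s) - k hk
    · exact coeff_quotientImage s hk
    · exact coeff_monomialImage s hk
  · intro k hk
    simp only [relationIndices, List.map_append, List.map_map, List.sum_append, Function.comp_def,
      Sum.elim_inl, Sum.elim_inr, h k hk, mul_neg]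
    rw [← List.sum_map_add]
    simp

/-- The polynomial whose graph contains the points of multiplicity `6`. -/
noncomputable def graphPoly : Polynomial ℂ := Polynomial.X ^ 4 + (Polynomial.X ^ 2 + 1)

/-- The substitution `x ↦ X`, `y ↦ Y + graphPoly`, as a polynomial in `Y` over `ℂ[X]`. -/
noncomputable def expandAlongGraph :
    MvPolynomial (Fin 2) ℂ →ₐ[ℂ] Polynomial (Polynomial ℂ) :=
  aeval ![Polynomial.C Polynomial.X, Polynomial.X + Polynomial.C graphPoly]

lemma pow_dvd_coeff_of_mem_pow {R : Type*} [CommRing R] (r : R) (m : ℕ) :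
    ∀ F ∈ Ideal.span {Polynomial.C r, Polynomial.X} ^ m, ∀ j, r ^ (m - j) ∣ F.coeff j := by
  induction m with
  | zero => simp
  | succ m ih =>
    intro F hF
    rw [pow_succ] at hF
    induction hF using Submodule.mul_induction_on' with
    | mem_mul_mem G hG H hH =>
      obtain ⟨A, B, rfl⟩ := Ideal.mem_span_pair.1 hH
      intro j
      have hGA := Ideal.mul_mem_right A _ hG
      have hGB := Ideal.mul_mem_right B _ hG
      rw [mul_add, ← mul_assoc, ← mul_assoc, Polynomial.coeff_add, Polynomial.coeff_mul_C]
      refine dvd_add ?_ ?_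
      · refine (pow_dvd_pow r (show m + 1 - j ≤ m - j + 1 by omega)).trans ?_
        rw [pow_succ]
        exact mul_dvd_mul_right (ih _ hGA j) r
      · rcases j with _ | j
        · simp
        · rw [Polynomial.coeff_mul_X, Nat.add_sub_add_right]
          exact ih _ hGB j
    | add G hG H hH ihG ihH => exact fun j => dvd_add (ihG j) (ihH j)

lemma pow_dvd_coeff_expandAlongGraph {f : MvPolynomial (Fin 2) ℂ} {z : ℂ} {m : ℕ}
    (hf : f ∈ ptIdeal (z, graphPoly.eval z) ^ m) (j : ℕ) :
    (Polynomial.X - Polynomial.C z) ^ (m - j) ∣ (expandAlongGraph f).coeff j := by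
  refine pow_dvd_coeff_of_mem_pow _ m _ ?_ j
  have hmap := Ideal.mem_map_of_mem expandAlongGraph hf
  rw [Ideal.map_pow] at hmap
  refine Ideal.pow_right_mono ?_ m hmap
  rw [ptIdeal, Ideal.map_span, Ideal.span_le, Set.image_pair]
  obtain ⟨A, hA⟩ := Polynomial.X_sub_C_dvd_sub_C_eval (p := graphPoly) (a := z)
  rintro _ (rfl | rfl)
  · refine Ideal.mem_span_pair.2 ⟨1, 0, ?_⟩
    simp [expandAlongGraph, Polynomial.algebraMap_apply]
  · refine Ideal.mem_span_pair.2 ⟨Polynomial.C A, 1, ?_⟩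
    have hC := congrArg (Polynomial.C (R := Polynomial ℂ)) hA
    simp only [map_sub, map_mul] at hC
    simp only [expandAlongGraph, map_sub, aeval_X, algHom_C, Polynomial.algebraMap_apply,
      Matrix.cons_val_one, Matrix.cons_val_fin_one, Algebra.algebraMap_self, RingHom.id_apply]
    linear_combination -hC

lemma X_pow_sub_one_pow_dvd {n : ℕ} (hn : 0 < n) {ζ : ℂ} (hζ : IsPrimitiveRoot ζ n) {e : ℕ}
    {P : Polynomial ℂ}
    (h : ∀ i < n, (Polynomial.X - Polynomial.C (ζ ^ i)) ^ e ∣ P) :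
    (Polynomial.X ^ n - 1) ^ e ∣ P := by
  rw [Polynomial.X_pow_sub_one_eq_prod hn hζ, ← Finset.prod_pow]
  refine Finset.prod_dvd_of_coprime ?_ ?_
  · intro a _ b _ hab
    exact (Polynomial.pairwise_coprime_X_sub_C Function.injective_id hab).pow
  · intro a ha
    have : NeZero n := ⟨hn.ne'⟩
    obtain ⟨i, hi, rfl⟩ := hζ.eq_pow_of_pow_eq_one ((Polynomial.mem_nthRootsFinset hn 1).1 ha)
    exact h i hi

lemma expandAlongGraph_eq_sum (f : MvPolynomial (Fin 2) ℂ) :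
    expandAlongGraph f = ∑ s ∈ f.support, Polynomial.C (Polynomial.C (f.coeff s) *
      Polynomial.X ^ s 0) * (Polynomial.X + Polynomial.C graphPoly) ^ s 1 := by
  rw [expandAlongGraph, aeval_def, eval₂_eq']
  refine Finset.sum_congr rfl fun s _ => ?_
  simp [Fin.prod_univ_two, Polynomial.algebraMap_apply, mul_assoc]

lemma natDegree_graphPoly : graphPoly.natDegree ≤ 4 := by
  unfold graphPoly
  compute_degree

lemma natDegree_coeff_expandAlongGraph {f : MvPolynomial (Fin 2) ℂ} {n : ℕ}
    (hf : f.totalDegree ≤ n) (j : ℕ) :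
    ((expandAlongGraph f).coeff j).natDegree ≤ 4 * (n - j) := by
  rw [expandAlongGraph_eq_sum, Polynomial.finsetSum_coeff]
  refine Polynomial.natDegree_sum_le_of_forall_le _ _ fun s hs => ?_
  rw [Polynomial.coeff_C_mul, Polynomial.coeff_X_add_C_pow]
  rcases lt_or_ge (s 1) j with hj | hj
  · simp [Nat.choose_eq_zero_of_lt hj]
  have hdeg : s 0 + s 1 ≤ n := by
    have := (le_totalDegree hs).trans hf
    rwa [Finsupp.sum_fintype _ _ (by simp), Fin.sum_univ_two] at this
  refine (Polynomial.natDegree_mul_le_of_le (Polynomial.natDegree_C_mul_X_pow_le _ _)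
    (Polynomial.natDegree_mul_le_of_le
      (Polynomial.natDegree_pow_le_of_le _ natDegree_graphPoly)
        (Polynomial.natDegree_natCast _).le)).trans ?_
  omega

/-- The exponent vector with entries `s.1` and `s.2`. -/
noncomputable def exponentVector (s : ℕ × ℕ) : Fin 2 →₀ ℕ :=
  Finsupp.equivFunOnFinite.symm ![s.1, s.2]

lemma exponentVector_apply (s : Fin 2 →₀ ℕ) : exponentVector (s 0, s 1) = s := by
  ext i
  fin_cases i <;> simp [exponentVector]

lemma mem_monomialExponents {s : ℕ × ℕ} :
    s ∈ monomialExponents ↔ 2 ≤ s.1 + s.2 ∧ s.1 + s.2 ≤ 22 := by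
  obtain ⟨a, b⟩ := s
  simp only [monomialExponents, List.mem_filter, List.mem_product, List.mem_range,
    Bool.and_eq_true, decide_eq_true_eq]
  omega

lemma mem_quotientExponents {s : ℕ × ℕ} :
    s ∈ quotientExponents ↔ s.1 < 6 ∧ s.2 < 11 + 9 * s.1 := by
  obtain ⟨j, i⟩ := s
  simp only [quotientExponents, List.mem_filter, List.mem_product, List.mem_range,
    decide_eq_true_eq]
  omega

lemma nodup_monomialExponents : monomialExponents.Nodup :=
  (List.nodup_range.product List.nodup_range).filter _

lemma nodup_quotientExponents : quotientExponents.Nodup :=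
  (List.nodup_range.product List.nodup_range).filter _

lemma mem_monomialExponents_of_mem_support {f : MvPolynomial (Fin 2) ℂ}
    (hf : f.totalDegree ≤ 22) (hmult : f ∈ ptIdeal (0, 0) ^ 2) {s : Fin 2 →₀ ℕ}
    (hs : s ∈ f.support) : (s 0, s 1) ∈ monomialExponents := by
  refine mem_monomialExponents.2 ⟨?_, ?_⟩
  · by_contra hlt
    refine mem_support_iff.1 hs ?_
    have hvars : ptIdeal (0, 0) = idealOfVars (Fin 2) ℂ := by
      rw [ptIdeal, idealOfVars]
      congr 1
      ext
      simp [Fin.exists_fin_two, eq_comm]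
    rw [hvars, mem_pow_idealOfVars_iff'] at hmult
    refine hmult s ?_
    rw [Finsupp.degree_eq_sum, Fin.sum_univ_two]
    omega
  · have := (le_totalDegree hs).trans hf
    rwa [Finsupp.sum_fintype _ _ (by simp), Fin.sum_univ_two] at this

lemma coeff_eval_expandAlongGraph {f : MvPolynomial (Fin 2) ℂ} (hf : f.totalDegree ≤ 22)
    (hmult : f ∈ ptIdeal (0, 0) ^ 2) (k : ℕ) :
    ((expandAlongGraph f).eval (Polynomial.X ^ 128)).coeff k =
      (monomialExponents.map fun s =>
        ((monomialImage s).coeff k : ℂ) * f.coeff (exponentVector s)).sum := by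
  rw [← List.sum_toFinset _ nodup_monomialExponents, expandAlongGraph_eq_sum,
    Polynomial.eval_finsetSum, Polynomial.finsetSum_coeff]
  refine Finset.sum_of_injOn (fun s => (s 0, s 1)) ?_ ?_ ?_ ?_
  · intro s _ t _ hst
    rw [← exponentVector_apply s, ← exponentVector_apply t]
    exact congrArg exponentVector hst
  · intro s hs
    exact List.mem_toFinset.2 (mem_monomialExponents_of_mem_support hf hmult hs)
  · intro s _ hs
    rw [notMem_support_iff.1, mul_zero]
    refine fun hmem => hs ⟨exponentVector s, hmem, ?_⟩
    simp [exponentVector]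
  · intro s _
    have himage : Polynomial.X ^ s 0 * (Polynomial.X ^ 128 + graphPoly) ^ s 1 =
        (monomialImage (s 0, s 1)).map (Int.castRingHom ℂ) := by
      simp [monomialImage, graphPoly]
    rw [exponentVector_apply]
    simp only [Polynomial.eval_mul, Polynomial.eval_pow, Polynomial.eval_add, Polynomial.eval_X,
      Polynomial.eval_C]
    rw [mul_assoc, himage, Polynomial.coeff_C_mul, Polynomial.coeff_map, mul_comm]
    rfl

lemma coeff_eval_X_pow (F : Polynomial (Polynomial ℂ)) {k n m : ℕ} (hk : k < n * m) :
    (F.eval (Polynomial.X ^ n)).coeff k =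
      ∑ j ∈ Finset.range m, (Polynomial.X ^ (n * j) * F.coeff j).coeff k := by
  rw [Polynomial.eval_eq_sum_range' (show F.natDegree < m + (F.natDegree + 1) by omega),
    Finset.sum_range_add, Polynomial.coeff_add, Polynomial.finsetSum_coeff,
    Polynomial.finsetSum_coeff]
  conv_rhs => rw [← add_zero (Finset.sum _ _)]
  refine congrArg₂ _ (Finset.sum_congr rfl fun j _ => ?_) (Finset.sum_eq_zero fun j _ => ?_)
  · rw [← pow_mul, mul_comm]
  · rw [← pow_mul, Polynomial.coeff_mul_X_pow', if_neg]
    have := Nat.mul_le_mul_left n (Nat.le_add_right m j)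
    omega

lemma natDegree_quotient_lt {P h : Polynomial ℂ} {e n : ℕ}
    (hP : P = (Polynomial.X ^ 13 - 1) ^ e * h) (hdeg : P.natDegree < 13 * e + n) (hn : 0 < n) :
    h.natDegree < n := by
  rcases eq_or_ne h 0 with rfl | hh
  · simpa using hn
  have hmonic : (Polynomial.X ^ 13 - 1 : Polynomial ℂ).Monic :=
    Polynomial.monic_X_pow_sub_C 1 (by norm_num)
  have hX : (Polynomial.X ^ 13 - 1 : Polynomial ℂ).natDegree = 13 :=
    Polynomial.natDegree_X_pow_sub_C (r := 1)
  rw [hP, (hmonic.pow e).natDegree_mul' hh, hmonic.natDegree_pow, hX] at hdeg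
  omega

theorem L22_2_6p13_empty :
    ∃ (p : ℂ × ℂ) (q : Fin 13 → ℂ × ℂ),
      ∀ f : MvPolynomial (Fin 2) ℂ, f.totalDegree ≤ 22 →
        f ∈ ptIdeal p ^ 2 → (∀ i, f ∈ ptIdeal (q i) ^ 6) → f = 0 := by
  have hζ := Complex.isPrimitiveRoot_exp 13 (by norm_num)
  set ζ := Complex.exp (2 * Real.pi * Complex.I / (13 : ℕ))
  refine ⟨(0, 0), fun i => (ζ ^ (i : ℕ), graphPoly.eval (ζ ^ (i : ℕ))), fun f hf hp hq => ?_⟩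
  have hdvd (j : ℕ) : (Polynomial.X ^ 13 - 1) ^ (6 - j) ∣ (expandAlongGraph f).coeff j :=
    X_pow_sub_one_pow_dvd (by norm_num) hζ fun i hi =>
      pow_dvd_coeff_expandAlongGraph (hq ⟨i, hi⟩) j
  choose h hh using hdvd
  have hdeg (j : ℕ) (hj : j < 6) : (h j).natDegree < 11 + 9 * j := by
    refine natDegree_quotient_lt (hh j) ?_ (by omega)
    have := natDegree_coeff_expandAlongGraph hf j
    omega
  have hzero := eq_zero_of_coeff_eq (fun s => f.coeff (exponentVector s))
    (fun s => (h s.1).coeff s.2) fun k hk => by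
    rw [← coeff_eval_expandAlongGraph hf hp, coeff_eval_X_pow (m := 6) _ hk,
      ← List.sum_toFinset _ nodup_quotientExponents,
      Finset.sum_subset (s₂ := Finset.range 6 ×ˢ Finset.range 56), Finset.sum_product]
    · refine Finset.sum_congr rfl fun j hj => ?_
      have hj6 := Finset.mem_range.1 hj
      rw [hh j, (h j).as_sum_range_C_mul_X_pow' (n := 56) (by have := hdeg j hj6; omega),
        Finset.mul_sum, Finset.mul_sum, Polynomial.finsetSum_coeff]
      refine Finset.sum_congr rfl fun i _ => ?_
      have himage : Polynomial.X ^ (128 * j + i) * (Polynomial.X ^ 13 - 1) ^ (6 - j) =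
          (quotientImage (j, i)).map (Int.castRingHom ℂ) := by
        simp [quotientImage]
      rw [← eq_intCast (Int.castRingHom ℂ), ← Polynomial.coeff_map (p := quotientImage (j, i)),
        ← himage, ← Polynomial.coeff_mul_C]
      congr 1
      ring
    · intro s hs
      have := mem_quotientExponents.1 (List.mem_toFinset.1 hs)
      simp only [Finset.mem_product, Finset.mem_range]
      omega
    · intro s hs hs'
      rw [List.mem_toFinset, mem_quotientExponents] at hs'
      have hj := Finset.mem_range.1 (Finset.mem_product.1 hs).1
      rw [Polynomial.coeff_eq_zero_of_natDegree_lt (p := h s.1) (by have := hdeg s.1 hj; omega),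
        mul_zero]
  ext s
  rw [coeff_zero]
  by_contra hs
  refine hs ?_
  rw [← exponentVector_apply s]
  exact hzero _ (mem_monomialExponents_of_mem_support hf hp (mem_support_iff.2 hs))
end
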